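/- Let C be a far-reaching subset of S₁ and let Y ∈ C^×× = (C^×)^×. Then there exists a sequence (Yⁿ) of elements of the solid, fork-convex hull of C (the smallest (process) solid and fork-convex subset of S₁ containing C) such that Yⁿ_q → Y_q a.s. for every q ∈ Dy, where Dy = {qT : q a dyadic rational in [0,1]}. -/

import Mathlib

open MeasureTheory Filter Set
open scoped NNReal ENNReal

variable {Ω : Type*}

/-- A real function is càdlàg on `[0,T]`: right-continuous at every `t ∈ [0,T)` and
with left limits at every `t ∈ (0,T]`. -/
def CadlagOn (T : ℝ) (f : ℝ → ℝ) : Prop :=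
  (∀ t ∈ Set.Ico (0 : ℝ) T, Filter.Tendsto f (nhdsWithin t (Set.Ioi t)) (nhds (f t))) ∧
  (∀ t ∈ Set.Ioc (0 : ℝ) T, ∃ L : ℝ, Filter.Tendsto f (nhdsWithin t (Set.Iio t)) (nhds L))

/-- A positive process on `[0,T]`: adapted, nonnegative, with càdlàg paths. -/
def PosProc {m0 : MeasurableSpace Ω} (μ : Measure Ω) (T : ℝ)
    (ℱ : Filtration ℝ m0) (X : ℝ → Ω → ℝ) : Prop :=
  (∀ t ∈ Set.Icc (0 : ℝ) T, StronglyMeasurable[ℱ t] (X t)) ∧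
  (∀ᵐ ω ∂μ, ∀ t ∈ Set.Icc (0 : ℝ) T, 0 ≤ X t ω) ∧
  (∀ᵐ ω ∂μ, CadlagOn T (fun t => X t ω))

/-- A nonnegative càdlàg supermartingale on `[0,T]`. -/
def SuperMG {m0 : MeasurableSpace Ω} (μ : Measure Ω) (T : ℝ)
    (ℱ : Filtration ℝ m0) (X : ℝ → Ω → ℝ) : Prop :=
  PosProc μ T ℱ X ∧ (∀ t ∈ Set.Icc (0 : ℝ) T, Integrable (X t) μ) ∧
  ∀ s t : ℝ, s ∈ Set.Icc (0 : ℝ) T → t ∈ Set.Icc (0 : ℝ) T → s ≤ t →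
    μ[X t | ℱ s] ≤ᵐ[μ] X s

/-- Membership in `S₁`: a nonnegative càdlàg supermartingale with `Y₀ ≤ 1`. -/
def S1mem {m0 : MeasurableSpace Ω} (μ : Measure Ω) (T : ℝ)
    (ℱ : Filtration ℝ m0) (X : ℝ → Ω → ℝ) : Prop :=
  SuperMG μ T ℱ X ∧ ∀ᵐ ω ∂μ, X 0 ω ≤ 1

/-- Membership in `V`: a nonincreasing positive process with `B₀ ≤ 1`. -/
def Vmem {m0 : MeasurableSpace Ω} (μ : Measure Ω) (T : ℝ)
    (ℱ : Filtration ℝ m0) (B : ℝ → Ω → ℝ) : Prop :=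
  PosProc μ T ℱ B ∧
  (∀ᵐ ω ∂μ, ∀ s ∈ Set.Icc (0 : ℝ) T, ∀ t ∈ Set.Icc (0 : ℝ) T, s ≤ t → B t ω ≤ B s ω) ∧
  (∀ᵐ ω ∂μ, B 0 ω ≤ 1)

/-- The process polar `C^×`: all positive processes `Y` such that `XY` is a
supermartingale with `X₀Y₀ ≤ 1` for every `X ∈ C`. -/
def procPolar {m0 : MeasurableSpace Ω} (μ : Measure Ω) (T : ℝ)
    (ℱ : Filtration ℝ m0) (C : Set (ℝ → Ω → ℝ)) : Set (ℝ → Ω → ℝ) :=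
  {Y | PosProc μ T ℱ Y ∧ ∀ X ∈ C,
    SuperMG μ T ℱ (fun t ω => X t ω * Y t ω) ∧ ∀ᵐ ω ∂μ, X 0 ω * Y 0 ω ≤ 1}

/-- (Process) solidity: stability under multiplication by elements of `V`. -/
def ProcSolid {m0 : MeasurableSpace Ω} (μ : Measure Ω) (T : ℝ)
    (ℱ : Filtration ℝ m0) (C : Set (ℝ → Ω → ℝ)) : Prop :=
  ∀ Y ∈ C, ∀ B : ℝ → Ω → ℝ, Vmem μ T ℱ B → (fun t ω => Y t ω * B t ω) ∈ C

/-- Fork-convexity (with the convention `0/0 = 0`, which holds for Lean division). -/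
def ForkConvex {m0 : MeasurableSpace Ω} (μ : Measure Ω) (T : ℝ)
    (ℱ : Filtration ℝ m0) (C : Set (ℝ → Ω → ℝ)) : Prop :=
  ∀ s ∈ Set.Icc (0 : ℝ) T, ∀ h : Ω → ℝ, StronglyMeasurable[ℱ s] h →
    (∀ ω, 0 ≤ h ω) → (∀ ω, h ω ≤ 1) →
    ∀ Y1 ∈ C, ∀ Y2 ∈ C, ∀ Y3 ∈ C,
      (fun t ω => if t < s then Y1 t ω
        else Y1 s ω * (h ω * (Y2 t ω / Y2 s ω) + (1 - h ω) * (Y3 t ω / Y3 s ω))) ∈ C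

/-- Fatou convergence of a sequence of positive processes. -/
def FatouConv {m0 : MeasurableSpace Ω} (μ : Measure Ω) (T : ℝ) (Yn : ℕ → ℝ → Ω → ℝ) (Y : ℝ → Ω → ℝ) : Prop :=
  ∃ T' : Set ℝ, T'.Countable ∧ T' ⊆ Set.Icc 0 T ∧ Set.Icc (0 : ℝ) T ⊆ closure T' ∧
    ∀ᵐ ω ∂μ,
      (∀ t ∈ Set.Ico (0 : ℝ) T,
        (ENNReal.ofReal (Y t ω)
            = Filter.liminf
                (fun s => Filter.liminf (fun n => ENNReal.ofReal (Yn n s ω)) Filter.atTop)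
                (nhdsWithin t (Set.Ioi t ∩ T')) ∧
         ENNReal.ofReal (Y t ω)
            = Filter.limsup
                (fun s => Filter.limsup (fun n => ENNReal.ofReal (Yn n s ω)) Filter.atTop)
                (nhdsWithin t (Set.Ioi t ∩ T')))) ∧
      Filter.Tendsto (fun n => Yn n T ω) Filter.atTop (nhds (Y T ω))

/-- Closedness under Fatou convergence. -/
def FatouClosed {m0 : MeasurableSpace Ω} (μ : Measure Ω) (T : ℝ)
    (ℱ : Filtration ℝ m0) (C : Set (ℝ → Ω → ℝ)) : Prop :=
  ∀ (Yn : ℕ → ℝ → Ω → ℝ) (Y : ℝ → Ω → ℝ), (∀ n, Yn n ∈ C) → PosProc μ T ℱ Y →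
    FatouConv μ T Yn Y → Y ∈ C

/-- A set of processes is far-reaching if it has an element with `Y_T > 0` a.s. -/
def FarReaching {m0 : MeasurableSpace Ω} (μ : Measure Ω) (T : ℝ) (C : Set (ℝ → Ω → ℝ)) : Prop :=
  ∃ Y ∈ C, ∀ᵐ ω ∂μ, 0 < Y T ω

/-- The solid, fork-convex hull of `C`: the smallest (process) solid and fork-convex
subset of `S₁` containing `C`. -/
def solidForkHull {m0 : MeasurableSpace Ω} (μ : Measure Ω) (T : ℝ)
    (ℱ : Filtration ℝ m0) (C : Set (ℝ → Ω → ℝ)) : Set (ℝ → Ω → ℝ) :=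
  ⋂₀ {D | D ⊆ {X | S1mem μ T ℱ X} ∧ ProcSolid μ T ℱ D ∧ ForkConvex μ T ℱ D ∧ C ⊆ D}

/-- Extended (`[0,∞]`-valued) conditional expectation of a (nonnegative) function,
defined as the supremum of the conditional expectations of its truncations. -/
noncomputable def econd {mΩ : MeasurableSpace Ω} (μ : Measure Ω)
    (m : MeasurableSpace Ω) (f : Ω → ℝ) : Ω → ℝ≥0∞ :=
  fun ω => ⨆ n : ℕ, ENNReal.ofReal ((μ[fun ω' => min (f ω') n | m]) ω)

/-- The dyadic points `{qT : q a dyadic rational in [0,1]}`. -/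
def dyadics (T : ℝ) : Set ℝ := {x | ∃ j k : ℕ, j ≤ 2 ^ k ∧ x = (j : ℝ) / 2 ^ k * T}

open scoped Topology

/-- An inequality of set integrals over a sub-σ-algebra extends to integrals against arbitrary
nonnegative functions measurable with respect to it. -/
lemma lintegral_mul_le_of_setLIntegral_le {m m0 : MeasurableSpace Ω} {μ : Measure Ω} (hm : m ≤ m0)
    {f g : Ω → ℝ≥0∞} (hf : AEMeasurable f μ) (hg : AEMeasurable g μ)
    (hfg : ∀ A, MeasurableSet[m] A → ∫⁻ ω in A, f ω ∂μ ≤ ∫⁻ ω in A, g ω ∂μ)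
    {h : Ω → ℝ≥0∞} (hh : Measurable[m] h) :
    ∫⁻ ω, h ω * f ω ∂μ ≤ ∫⁻ ω, h ω * g ω ∂μ := by
  have hle : (μ.withDensity f).trim hm ≤ (μ.withDensity g).trim hm := by
    refine Measure.le_iff.2 fun A hA => ?_
    rw [trim_measurableSet_eq hm hA, trim_measurableSet_eq hm hA,
      withDensity_apply _ (hm A hA), withDensity_apply _ (hm A hA)]
    exact hfg A hA
  have key : ∀ {k : Ω → ℝ≥0∞}, AEMeasurable k μ →
      ∫⁻ ω, h ω * k ω ∂μ = ∫⁻ ω, h ω ∂((μ.withDensity k).trim hm) := by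
    intro k hk
    rw [lintegral_trim hm hh,
      lintegral_withDensity_eq_lintegral_mul₀ hk (hh.mono hm le_rfl).aemeasurable]
    simp [mul_comm]
  rw [key hf, key hg]
  exact lintegral_mono' hle le_rfl

lemma lintegral_mul_condLExp {m m0 : MeasurableSpace Ω} {μ : Measure Ω} [IsFiniteMeasure μ]
    (hm : m ≤ m0) {f : Ω → ℝ≥0∞} (hf : AEMeasurable f μ) {h : Ω → ℝ≥0∞} (hh : Measurable[m] h) :
    ∫⁻ ω, h ω * condLExp m μ f ω ∂μ = ∫⁻ ω, h ω * f ω ∂μ := by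
  have hc := (measurable_condLExp' m μ f).aemeasurable (μ := μ)
  refine le_antisymm
    (lintegral_mul_le_of_setLIntegral_le hm hc hf (fun A hA => ?_) hh)
    (lintegral_mul_le_of_setLIntegral_le hm hf hc (fun A hA => ?_) hh)
  · exact (setLIntegral_condLExp hm μ f hA).le
  · exact (setLIntegral_condLExp hm μ f hA).ge

lemma PosProc.nonneg {m0 : MeasurableSpace Ω} {μ : Measure Ω} {T : ℝ} {ℱ : Filtration ℝ m0}
    {X : ℝ → Ω → ℝ} (hX : PosProc μ T ℱ X) {t : ℝ} (ht : t ∈ Icc (0 : ℝ) T) : 0 ≤ᵐ[μ] X t := by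
  filter_upwards [hX.2.1] with ω h using h t ht

lemma PosProc.measurable_ofReal {m0 : MeasurableSpace Ω} {μ : Measure Ω} {T : ℝ}
    {ℱ : Filtration ℝ m0} {X : ℝ → Ω → ℝ} (hX : PosProc μ T ℱ X) {t : ℝ}
    (ht : t ∈ Icc (0 : ℝ) T) : Measurable[ℱ t] fun ω => ENNReal.ofReal (X t ω) :=
  (hX.1 t ht).measurable.ennreal_ofReal

lemma PosProc.measurable_ofReal' {m0 : MeasurableSpace Ω} {μ : Measure Ω} {T : ℝ}
    {ℱ : Filtration ℝ m0} {X : ℝ → Ω → ℝ} (hX : PosProc μ T ℱ X) {t : ℝ}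
    (ht : t ∈ Icc (0 : ℝ) T) : Measurable fun ω => ENNReal.ofReal (X t ω) :=
  (hX.measurable_ofReal ht).mono (ℱ.le t) le_rfl

/-- The supermartingale inequality tested against nonnegative measurable functions. -/
lemma SuperMG.lintegral_mul_le {m0 : MeasurableSpace Ω} {μ : Measure Ω} [IsFiniteMeasure μ]
    {T : ℝ} {ℱ : Filtration ℝ m0} {X : ℝ → Ω → ℝ} (hX : SuperMG μ T ℱ X) {s t : ℝ}
    (hs : s ∈ Icc (0 : ℝ) T) (ht : t ∈ Icc (0 : ℝ) T) (hst : s ≤ t) {h : Ω → ℝ≥0∞}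
    (hh : Measurable[ℱ s] h) :
    ∫⁻ ω, h ω * ENNReal.ofReal (X t ω) ∂μ ≤ ∫⁻ ω, h ω * ENNReal.ofReal (X s ω) ∂μ := by
  refine lintegral_mul_le_of_setLIntegral_le (ℱ.le s) (hX.1.measurable_ofReal' ht).aemeasurable
    (hX.1.measurable_ofReal' hs).aemeasurable (fun A hA => ?_) hh
  rw [← ofReal_integral_eq_lintegral_ofReal (hX.2.1 t ht).integrableOn
      (ae_restrict_of_ae (hX.1.nonneg ht)),
    ← ofReal_integral_eq_lintegral_ofReal (hX.2.1 s hs).integrableOn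
      (ae_restrict_of_ae (hX.1.nonneg hs))]
  refine ENNReal.ofReal_le_ofReal ?_
  rw [← setIntegral_condExp (ℱ.le s) (hX.2.1 t ht) hA]
  exact setIntegral_mono_ae integrable_condExp.integrableOn (hX.2.1 s hs).integrableOn
    (hX.2.2 s t hs ht hst)

lemma SuperMG.lintegral_lt_top {m0 : MeasurableSpace Ω} {μ : Measure Ω}
    {T : ℝ} {ℱ : Filtration ℝ m0} {X : ℝ → Ω → ℝ} (hX : SuperMG μ T ℱ X) {t : ℝ}
    (ht : t ∈ Icc (0 : ℝ) T) : ∫⁻ ω, ENNReal.ofReal (X t ω) ∂μ < ∞ := by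
  rw [← ofReal_integral_eq_lintegral_ofReal (hX.2.1 t ht) (hX.1.nonneg ht)]
  exact ENNReal.ofReal_lt_top

/-- Converse to the set-integral form of the supermartingale inequality. -/
lemma condExp_le_of_setLIntegral_le {m m0 : MeasurableSpace Ω} {μ : Measure Ω}
    [IsFiniteMeasure μ] (hm : m ≤ m0) {f g : Ω → ℝ} (hf : Integrable f μ) (hg : Integrable g μ)
    (hgm : StronglyMeasurable[m] g) (hf0 : 0 ≤ᵐ[μ] f) (hg0 : 0 ≤ᵐ[μ] g)
    (h : ∀ A, MeasurableSet[m] A →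
      ∫⁻ ω in A, ENNReal.ofReal (f ω) ∂μ ≤ ∫⁻ ω in A, ENNReal.ofReal (g ω) ∂μ) :
    μ[f | m] ≤ᵐ[μ] g := by
  refine ae_le_of_ae_le_trim (hm := hm) ?_
  refine ae_le_of_forall_setIntegral_le (integrable_condExp.trim hm stronglyMeasurable_condExp)
    (hg.trim hm hgm) fun A hA _ => ?_
  rw [← setIntegral_trim hm stronglyMeasurable_condExp hA, ← setIntegral_trim hm hgm hA,
    setIntegral_condExp hm hf hA]
  have := h A hA
  rw [← ofReal_integral_eq_lintegral_ofReal hf.integrableOn (ae_restrict_of_ae hf0),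
    ← ofReal_integral_eq_lintegral_ofReal hg.integrableOn (ae_restrict_of_ae hg0)] at this
  exact (ENNReal.ofReal_le_ofReal_iff (integral_nonneg_of_ae (ae_restrict_of_ae hg0))).1 this

/-- Building a supermartingale from the set-integral form of the inequality. -/
lemma SuperMG.of_setLIntegral_le {m0 : MeasurableSpace Ω} {μ : Measure Ω} [IsFiniteMeasure μ]
    {T : ℝ} {ℱ : Filtration ℝ m0} {X : ℝ → Ω → ℝ} (hX : PosProc μ T ℱ X)
    (hfin : ∀ t ∈ Icc (0 : ℝ) T, ∫⁻ ω, ENNReal.ofReal (X t ω) ∂μ < ∞)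
    (h : ∀ s t : ℝ, s ∈ Icc (0 : ℝ) T → t ∈ Icc (0 : ℝ) T → s ≤ t → ∀ A, MeasurableSet[ℱ s] A →
      ∫⁻ ω in A, ENNReal.ofReal (X t ω) ∂μ ≤ ∫⁻ ω in A, ENNReal.ofReal (X s ω) ∂μ) :
    SuperMG μ T ℱ X := by
  have hinte : ∀ t ∈ Icc (0 : ℝ) T, Integrable (X t) μ := fun t ht =>
    ⟨((hX.1 t ht).mono (ℱ.le t)).aestronglyMeasurable,
      (hasFiniteIntegral_iff_ofReal (hX.nonneg ht)).2 (hfin t ht)⟩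
  exact ⟨hX, hinte, fun s t hs ht hst => condExp_le_of_setLIntegral_le (ℱ.le s) (hinte t ht)
    (hinte s hs) (hX.1 s hs) (hX.nonneg ht) (hX.nonneg hs) (h s t hs ht hst)⟩

/-- A nonnegative supermartingale stays at zero. -/
lemma SuperMG.ae_eq_zero_of_eq_zero {m0 : MeasurableSpace Ω} {μ : Measure Ω} [IsFiniteMeasure μ]
    {T : ℝ} {ℱ : Filtration ℝ m0} {X : ℝ → Ω → ℝ} (hX : SuperMG μ T ℱ X) {s t : ℝ}
    (hs : s ∈ Icc (0 : ℝ) T) (ht : t ∈ Icc (0 : ℝ) T) (hst : s ≤ t) :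
    ∀ᵐ ω ∂μ, X s ω = 0 → X t ω = 0 := by
  obtain ⟨A, hAdef⟩ : ∃ A : Set Ω, ∀ ω, ω ∈ A ↔ X s ω = 0 := ⟨{ω | X s ω = 0}, fun _ => Iff.rfl⟩
  have hA : MeasurableSet[ℱ s] A := by
    have : A = X s ⁻¹' {0} := by ext ω; simp [hAdef]
    rw [this]
    exact (hX.1.1 s hs).measurable (measurableSet_singleton 0)
  have h := hX.lintegral_mul_le hs ht hst (h := A.indicator fun _ => 1)
    (Measurable.indicator measurable_const hA)
  have h0 : ∫⁻ ω, A.indicator (fun _ => 1) ω * ENNReal.ofReal (X s ω) ∂μ = 0 := by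
    refine (lintegral_congr fun ω => ?_).trans lintegral_zero
    by_cases hω : ω ∈ A
    · simp [(hAdef ω).1 hω]
    · simp [hω]
  rw [h0, nonpos_iff_eq_zero, lintegral_eq_zero_iff] at h
  · filter_upwards [h, hX.1.nonneg ht] with ω h1 h2 h3
    simp only [indicator, (hAdef ω).2 h3, ↓reduceIte, one_mul, Pi.zero_apply,
      ENNReal.ofReal_eq_zero] at h1
    exact le_antisymm h1 h2
  · exact (Measurable.indicator measurable_const (ℱ.le s A hA)).mul (hX.1.measurable_ofReal' ht)

/-- A far-reaching, solid and fork-convex family of elements of `S₁`. -/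
structure StableFamily {m0 : MeasurableSpace Ω} (μ : Measure Ω) (T : ℝ)
    (ℱ : Filtration ℝ m0) (K : Set (ℝ → Ω → ℝ)) : Prop where
  s1mem : ∀ X ∈ K, S1mem μ T ℱ X
  solid : ProcSolid μ T ℱ K
  fork : ForkConvex μ T ℱ K
  far : FarReaching μ T K

/-- The ratios `Z_t / Z_s` of those elements `Z` of `K` that are positive at time `s`. -/
def ratioSet {m0 : MeasurableSpace Ω} (μ : Measure Ω) (ℱ : Filtration ℝ m0)
    (K : Set (ℝ → Ω → ℝ)) (s t : ℝ) : Set (Ω → ℝ≥0∞) :=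
  {ρ | Measurable[ℱ t] ρ ∧ ∃ Z ∈ K, (∀ᵐ ω ∂μ, 0 < Z s ω) ∧
    ∀ᵐ ω ∂μ, ENNReal.ofReal (Z t ω) = ENNReal.ofReal (Z s ω) * ρ ω}

lemma SuperMG.ae_pos_of_le {m0 : MeasurableSpace Ω} {μ : Measure Ω} [IsFiniteMeasure μ]
    {T : ℝ} {ℱ : Filtration ℝ m0} {X : ℝ → Ω → ℝ} (hX : SuperMG μ T ℱ X) {s t : ℝ}
    (hs : s ∈ Icc (0 : ℝ) T) (ht : t ∈ Icc (0 : ℝ) T) (hst : s ≤ t)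
    (hpos : ∀ᵐ ω ∂μ, 0 < X t ω) : ∀ᵐ ω ∂μ, 0 < X s ω := by
  filter_upwards [hX.ae_eq_zero_of_eq_zero hs ht hst, hX.1.nonneg hs, hpos] with ω h1 h2 h3
  exact lt_of_le_of_ne h2 fun h => h3.ne' (h1 h.symm)

namespace StableFamily

variable {m0 : MeasurableSpace Ω} {μ : Measure Ω} [IsFiniteMeasure μ] {T : ℝ}
  {ℱ : Filtration ℝ m0} {K : Set (ℝ → Ω → ℝ)}

lemma exists_pos (hK : StableFamily μ T ℱ K) :
    ∃ Z ∈ K, ∀ s ∈ Icc (0 : ℝ) T, ∀ᵐ ω ∂μ, 0 < Z s ω := by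
  obtain ⟨Z, hZ, hpos⟩ := hK.far
  exact ⟨Z, hZ, fun s hs => (hK.s1mem Z hZ).1.ae_pos_of_le hs ⟨hs.1.trans hs.2, le_rfl⟩ hs.2 hpos⟩

lemma lintegral_ratio_le (hK : StableFamily μ T ℱ K) {s t : ℝ} (hs : s ∈ Icc (0 : ℝ) T)
    (ht : t ∈ Icc (0 : ℝ) T) (hst : s ≤ t) {ρ : Ω → ℝ≥0∞} (hρ : ρ ∈ ratioSet μ ℱ K s t)
    {h : Ω → ℝ≥0∞} (hh : Measurable[ℱ s] h) :
    ∫⁻ ω, h ω * ρ ω ∂μ ≤ ∫⁻ ω, h ω ∂μ := by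
  obtain ⟨hρm, Z, hZ, hpos, heq⟩ := hρ
  have hS := (hK.s1mem Z hZ).1
  have key := hS.lintegral_mul_le hs ht hst
    (h := fun ω => h ω * (ENNReal.ofReal (Z s ω))⁻¹) (hh.mul (hS.1.measurable_ofReal hs).inv)
  convert key using 1
  · refine lintegral_congr_ae ?_
    filter_upwards [hpos, heq] with ω h1 h2
    rw [h2, mul_assoc, ← mul_assoc (_⁻¹), ENNReal.inv_mul_cancel, one_mul]
    · simpa using h1
    · simp
  · refine lintegral_congr_ae ?_
    filter_upwards [hpos] with ω h1
    rw [mul_assoc, ENNReal.inv_mul_cancel, mul_one]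
    · simpa using h1
    · simp

lemma mix_mem_ratioSet (hK : StableFamily μ T ℱ K) {s t : ℝ} (hs : s ∈ Icc (0 : ℝ) T)
    (ht : t ∈ Icc (0 : ℝ) T) (hst : s ≤ t) {ρ₁ ρ₂ : Ω → ℝ≥0∞} (h₁ : ρ₁ ∈ ratioSet μ ℱ K s t)
    (h₂ : ρ₂ ∈ ratioSet μ ℱ K s t) {h : Ω → ℝ} (hh : StronglyMeasurable[ℱ s] h)
    (h0 : ∀ ω, 0 ≤ h ω) (h1 : ∀ ω, h ω ≤ 1) :
    (fun ω => ENNReal.ofReal (h ω) * ρ₁ ω + ENNReal.ofReal (1 - h ω) * ρ₂ ω)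
      ∈ ratioSet μ ℱ K s t := by
  obtain ⟨hm₁, Z₁, hZ₁, hpos₁, heq₁⟩ := h₁
  obtain ⟨hm₂, Z₂, hZ₂, hpos₂, heq₂⟩ := h₂
  obtain ⟨Z, hZ, hpos⟩ := hK.exists_pos
  have hht : Measurable[ℱ t] h := (hh.mono (ℱ.mono hst)).measurable
  refine ⟨(hht.ennreal_ofReal.mul hm₁).add ((measurable_const.sub hht).ennreal_ofReal.mul hm₂),
    _, hK.fork s hs h hh h0 h1 Z hZ Z₁ hZ₁ Z₂ hZ₂, ?_, ?_⟩
  · filter_upwards [hpos s hs, hpos₁, hpos₂] with ω p p₁ p₂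
    simpa [p₁.ne', p₂.ne'] using p
  · filter_upwards [hpos s hs, hpos₁, hpos₂, heq₁, heq₂, (hK.s1mem Z₁ hZ₁).1.1.nonneg ht,
      (hK.s1mem Z₂ hZ₂).1.1.nonneg ht] with ω p p₁ p₂ e₁ e₂ n₁ n₂
    have q₁ : ENNReal.ofReal (Z₁ t ω / Z₁ s ω) = ρ₁ ω := by
      rw [ENNReal.ofReal_div_of_pos p₁, e₁, mul_comm, ENNReal.mul_div_cancel_right] <;> simp [p₁]
    have q₂ : ENNReal.ofReal (Z₂ t ω / Z₂ s ω) = ρ₂ ω := by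
      rw [ENNReal.ofReal_div_of_pos p₂, e₂, mul_comm, ENNReal.mul_div_cancel_right] <;> simp [p₂]
    have p₀ : (0 : ℝ) ≤ 1 - h ω := sub_nonneg.2 (h1 ω)
    simp only [lt_self_iff_false, ↓reduceIte, not_lt.2 hst, div_self p₁.ne', div_self p₂.ne']
    rw [ENNReal.ofReal_mul p.le]
    simp only [mul_one, add_sub_cancel]
    congr 1
    rw [ENNReal.ofReal_add (mul_nonneg (h0 ω) (div_nonneg n₁ p₁.le))
      (mul_nonneg p₀ (div_nonneg n₂ p₂.le)), ENNReal.ofReal_mul (h0 ω), ENNReal.ofReal_mul p₀,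
      q₁, q₂]

lemma mem_ratioSet_of_le (hK : StableFamily μ T ℱ K) {s t : ℝ} (ht : t ∈ Icc (0 : ℝ) T)
    (hst : s < t) {ρ ρ' : Ω → ℝ≥0∞} (hρ : ρ ∈ ratioSet μ ℱ K s t)
    (hm : Measurable[ℱ t] ρ') (hle : ∀ ω, ρ' ω ≤ ρ ω) : ρ' ∈ ratioSet μ ℱ K s t := by
  obtain ⟨hρm, Z, hZ, hpos, heq⟩ := hρ
  have hr : ∀ ω, ρ' ω / ρ ω ≤ 1 := fun ω => ENNReal.div_le_of_le_mul (by simpa using hle ω)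
  have hr1 : ∀ ω, (ρ' ω / ρ ω).toReal ≤ 1 := fun ω => by
    simpa using ENNReal.toReal_mono ENNReal.one_ne_top (hr ω)
  set B : ℝ → Ω → ℝ := fun u ω => if u < t then 1 else (ρ' ω / ρ ω).toReal with hB
  have hBV : Vmem μ T ℱ B := by
    refine ⟨⟨fun u hu => ?_, ?_, ?_⟩, ?_, ?_⟩
    · by_cases hut : u < t
      · simpa [hB, hut] using stronglyMeasurable_const
      · simp only [hB, hut, ↓reduceIte]
        exact ((hm.div hρm).ennreal_toReal.mono (ℱ.mono (not_lt.1 hut)) le_rfl).stronglyMeasurable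
    · refine ae_of_all _ fun ω u _ => ?_
      simp only [hB]
      split_ifs <;> positivity
    · refine ae_of_all _ fun ω => ⟨fun u _ => ?_, fun u _ => ?_⟩
      · refine tendsto_const_nhds.congr' ?_
        by_cases hut : u < t
        · filter_upwards [mem_nhdsWithin_of_mem_nhds (Iio_mem_nhds hut)] with v hv
          simp [hB, hut, mem_Iio.1 hv]
        · filter_upwards [self_mem_nhdsWithin] with v hv
          simp [hB, hut, not_lt.2 ((not_lt.1 hut).trans (le_of_lt (mem_Ioi.1 hv)))]
      · by_cases hut : u ≤ t
        · refine ⟨1, tendsto_const_nhds.congr' ?_⟩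
          filter_upwards [self_mem_nhdsWithin] with v hv
          simp [hB, (mem_Iio.1 hv).trans_le hut]
        · refine ⟨(ρ' ω / ρ ω).toReal, tendsto_const_nhds.congr' ?_⟩
          filter_upwards [mem_nhdsWithin_of_mem_nhds (Ioi_mem_nhds (not_le.1 hut))] with v hv
          simp [hB, not_lt.2 (le_of_lt (mem_Ioi.1 hv))]
    · refine ae_of_all _ fun ω u _ v _ huv => ?_
      simp only [hB]
      split_ifs with a b b
      · exact le_rfl
      · exact absurd (huv.trans_lt a) b
      · exact hr1 ω
      · exact le_rfl
    · refine ae_of_all _ fun ω => ?_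
      simp only [hB]
      split_ifs
      · exact le_rfl
      · exact hr1 ω
  refine ⟨hm, _, hK.solid Z hZ B hBV, ?_, ?_⟩
  · filter_upwards [hpos] with ω p
    simpa [hB, hst] using p
  · filter_upwards [hpos, heq, (hK.s1mem Z hZ).1.1.nonneg ht] with ω p e n
    simp only [hB, hst, lt_self_iff_false, ↓reduceIte, mul_one]
    rw [ENNReal.ofReal_mul n, e, ENNReal.ofReal_toReal ((hr ω).trans_lt ENNReal.one_lt_top).ne,
      mul_assoc]
    congr 1
    have htop : ρ ω ≠ ∞ := by
      intro h
      rw [h, ENNReal.mul_top (by simpa using p)] at e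
      simp at e
    by_cases hz : ρ ω = 0
    · have := hle ω
      simp_all
    · exact ENNReal.mul_div_cancel hz htop

/-- Continuing `Z` from time `v` on with a given ratio. -/
lemma exists_concat (hK : StableFamily μ T ℱ K) {v t : ℝ} (hv : v ∈ Icc (0 : ℝ) T)
    (hvt : v ≤ t) {Z : ℝ → Ω → ℝ} (hZ : Z ∈ K) {ρ : Ω → ℝ≥0∞} (hρ : ρ ∈ ratioSet μ ℱ K v t) :
    ∃ Z' ∈ K, (∀ u < v, Z' u = Z u) ∧ Z' v =ᵐ[μ] Z v ∧
      ∀ᵐ ω ∂μ, ENNReal.ofReal (Z' t ω) = ENNReal.ofReal (Z v ω) * ρ ω := by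
  obtain ⟨hρm, V, hV, hpos, heq⟩ := hρ
  refine ⟨_, hK.fork v hv (fun _ => 1) stronglyMeasurable_const (fun _ => zero_le_one)
    (fun _ => le_rfl) Z hZ V hV V hV, ?_, ?_, ?_⟩
  · intro u hu
    ext ω
    simp [hu]
  · filter_upwards [hpos] with ω p
    simp [p.ne']
  · filter_upwards [hpos, heq, (hK.s1mem Z hZ).1.1.nonneg hv] with ω p e n
    simp only [not_lt.2 hvt, ↓reduceIte, one_mul, sub_self, zero_mul, add_zero]
    rw [ENNReal.ofReal_mul n, ENNReal.ofReal_div_of_pos p, e, mul_comm (ENNReal.ofReal (V v ω)),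
      ENNReal.mul_div_cancel_right] <;> simp [p]

lemma exists_ratio_ge (hK : StableFamily μ T ℱ K) {s t : ℝ} (hs : s ∈ Icc (0 : ℝ) T)
    (ht : t ∈ Icc (0 : ℝ) T) (hst : s ≤ t) {Z : ℝ → Ω → ℝ} (hZ : Z ∈ K) :
    ∃ ρ ∈ ratioSet μ ℱ K s t,
      ∀ᵐ ω ∂μ, ENNReal.ofReal (Z t ω) ≤ ENNReal.ofReal (Z s ω) * ρ ω := by
  classical
  obtain ⟨Zf, hZf, hposf⟩ := hK.exists_pos
  have hS := (hK.s1mem Z hZ).1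
  have hSf := (hK.s1mem Zf hZf).1
  obtain ⟨A, hAdef⟩ : ∃ A : Set Ω, ∀ ω, ω ∈ A ↔ 0 < Z s ω := ⟨{ω | 0 < Z s ω}, fun _ => Iff.rfl⟩
  have hA : MeasurableSet[ℱ s] A := by
    have : A = Z s ⁻¹' Ioi 0 := by ext ω; simp [hAdef]
    rw [this]
    exact (hS.1.1 s hs).measurable measurableSet_Ioi
  set h : Ω → ℝ := A.indicator fun _ => 1 with hh
  have hm : StronglyMeasurable[ℱ s] h := stronglyMeasurable_const.indicator hA
  have h0 : ∀ ω, 0 ≤ h ω := fun ω => indicator_nonneg (fun _ _ => zero_le_one) ω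
  have h1 : ∀ ω, h ω ≤ 1 := fun ω => indicator_le_self' (fun _ _ => zero_le_one) ω
  have hfork := hK.fork s hs h hm h0 h1 Zf hZf Z hZ Zf hZf
  set V : ℝ → Ω → ℝ := fun t ω => if t < s then Zf t ω
        else Zf s ω * (h ω * (Z t ω / Z s ω) + (1 - h ω) * (Zf t ω / Zf s ω)) with hV
  have hVs : ∀ᵐ ω ∂μ, V s ω = Zf s ω := by
    filter_upwards [hposf s hs] with ω p
    by_cases hω : ω ∈ A
    · simp [hV, hh, hω, ((hAdef ω).1 hω).ne']
    · simp [hV, hh, hω, p.ne']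
  refine ⟨fun ω => ENNReal.ofReal (h ω * (Z t ω / Z s ω) + (1 - h ω) * (Zf t ω / Zf s ω)),
    ⟨?_, V, hfork, ?_, ?_⟩, ?_⟩
  · have a1 := ((hS.1.1 s hs).mono (ℱ.mono hst)).measurable
    have a2 := ((hSf.1.1 s hs).mono (ℱ.mono hst)).measurable
    have a3 := (hS.1.1 t ht).measurable
    have a4 := (hSf.1.1 t ht).measurable
    have a5 := (hm.mono (ℱ.mono hst)).measurable
    exact ((a5.mul (a3.div a1)).add ((measurable_const.sub a5).mul (a4.div a2))).ennreal_ofReal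
  · filter_upwards [hVs, hposf s hs] with ω e p
    rwa [e]
  · filter_upwards [hVs, hposf s hs] with ω e p
    rw [e, ← ENNReal.ofReal_mul p.le]
    simp [hV, not_lt.2 hst]
  · filter_upwards [hS.ae_eq_zero_of_eq_zero hs ht hst, hS.1.nonneg hs] with ω z n
    by_cases hω : ω ∈ A
    · have p := (hAdef ω).1 hω
      rw [← ENNReal.ofReal_mul n]
      simp [hh, hω, mul_div_cancel₀ _ p.ne', mul_div_assoc']
    · have : Z s ω = 0 := le_antisymm (not_lt.1 fun h => hω ((hAdef ω).2 h)) n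
      simp [z this]

end StableFamily

lemma measurableSet_le_of_measurable {m : MeasurableSpace Ω} {f g : Ω → ℝ≥0∞}
    (hf : Measurable f) (hg : Measurable g) : MeasurableSet {ω | f ω ≤ g ω} :=
  measurableSet_le hf hg

/-- The essential supremum of an upward directed family of functions bounded by `1`. -/
lemma exists_ae_sup_of_directed {m m0 : MeasurableSpace Ω} {μ : Measure Ω} [IsFiniteMeasure μ]
    (hm : m ≤ m0) {Φ : Set (Ω → ℝ≥0∞)} (hne : Φ.Nonempty) (hmeas : ∀ φ ∈ Φ, Measurable[m] φ)
    (hle : ∀ φ ∈ Φ, ∀ᵐ ω ∂μ, φ ω ≤ 1)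
    (hdir : ∀ φ ∈ Φ, ∀ ψ ∈ Φ, ∃ χ ∈ Φ, φ ≤ᵐ[μ] χ ∧ ψ ≤ᵐ[μ] χ) :
    ∃ J : Ω → ℝ≥0∞, Measurable[m] J ∧ (∀ ω, J ω ≤ 1) ∧ (∀ φ ∈ Φ, φ ≤ᵐ[μ] J) ∧
      ∀ h : Ω → ℝ≥0∞, Measurable h → ∀ x, (∀ φ ∈ Φ, ∫⁻ ω, h ω * φ ω ∂μ ≤ x) →
        ∫⁻ ω, h ω * J ω ∂μ ≤ x := by
  have hmeas0 : ∀ φ ∈ Φ, Measurable φ := fun φ hφ => (hmeas φ hφ).mono hm le_rfl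
  set I : Set ℝ≥0∞ := (fun φ : Ω → ℝ≥0∞ => ∫⁻ ω, φ ω ∂μ) '' Φ with hI
  obtain ⟨x, -, hx, hxI⟩ := exists_seq_tendsto_sSup (hne.image _ : I.Nonempty) (OrderTop.bddAbove I)
  choose ψ hψ hψx using hxI
  choose! c hcΦ hc₁ hc₂ using hdir
  let χ : ℕ → Ω → ℝ≥0∞ := fun n => Nat.rec (ψ 0) (fun k f => c f (ψ k)) n
  have hχ : ∀ n, χ n ∈ Φ := fun n => by
    induction n with
    | zero => exact hψ 0
    | succ k ih => exact hcΦ _ ih _ (hψ k)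
  have hχmono : ∀ n, χ n ≤ᵐ[μ] χ (n + 1) := fun n => hc₁ _ (hχ n) _ (hψ n)
  have hχψ : ∀ n, ψ n ≤ᵐ[μ] χ (n + 1) := fun n => hc₂ _ (hχ n) _ (hψ n)
  set J : Ω → ℝ≥0∞ := fun ω => ⨆ n, min (χ n ω) 1 with hJ
  have hJm : Measurable[m] J := Measurable.iSup fun n => (hmeas _ (hχ n)).min measurable_const
  have hJ' : ∀ᵐ ω ∂μ, J ω = ⨆ n, χ n ω := by
    filter_upwards [ae_all_iff.2 fun n => hle _ (hχ n)] with ω h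
    simp [hJ, h]
  have hsup : ∀ φ ∈ Φ, ∫⁻ ω, φ ω ∂μ ≤ sSup I := fun φ hφ => le_sSup ⟨φ, hφ, rfl⟩
  have hJint : ∫⁻ ω, J ω ∂μ = sSup I := by
    rw [lintegral_congr_ae hJ', lintegral_iSup_ae (fun n => hmeas0 _ (hχ n)) hχmono]
    refine le_antisymm (iSup_le fun n => hsup _ (hχ n)) (le_of_tendsto' hx fun n => ?_)
    rw [← hψx n]
    exact (lintegral_mono_ae (hχψ n)).trans (le_iSup (fun n => ∫⁻ ω, χ n ω ∂μ) (n + 1))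
  have hfin : ∫⁻ ω, J ω ∂μ ≠ ∞ := by
    refine ((lintegral_mono (g := fun _ => 1) fun ω => ?_).trans_lt ?_).ne
    · exact iSup_le fun n => min_le_right _ _
    · simp
  refine ⟨J, hJm, fun ω => iSup_le fun n => min_le_right _ _, fun φ hφ => ?_, fun h hh x hx => ?_⟩
  · have hmax : J =ᵐ[μ] fun ω => max (φ ω) (J ω) := by
      refine ae_eq_of_ae_le_of_lintegral_le (ae_of_all _ fun ω => le_max_right _ _) hfin
        ((hmeas0 φ hφ).max (hJm.mono hm le_rfl)).aemeasurable ?_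
      rw [hJint]
      have : ∀ᵐ ω ∂μ, max (φ ω) (J ω) = ⨆ n, max (φ ω) (χ n ω) := by
        filter_upwards [hJ'] with ω h
        rw [h, sup_iSup]
      rw [lintegral_congr_ae this, lintegral_iSup_ae (fun n => (hmeas0 φ hφ).max (hmeas0 _ (hχ n)))]
      · refine iSup_le fun n => ?_
        refine (lintegral_mono_ae ?_).trans (hsup _ (hcΦ _ hφ _ (hχ n)))
        filter_upwards [hc₁ _ hφ _ (hχ n), hc₂ _ hφ _ (hχ n)] with ω a b using max_le a b
      · intro n
        filter_upwards [hχmono n] with ω a using max_le_max le_rfl a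
    filter_upwards [hmax] with ω h
    rw [h]
    exact le_max_left _ _
  · have : ∀ᵐ ω ∂μ, h ω * J ω = ⨆ n, h ω * χ n ω := by
      filter_upwards [hJ'] with ω h
      rw [h, ENNReal.mul_iSup]
    rw [lintegral_congr_ae this, lintegral_iSup_ae (f := fun n ω => h ω * χ n ω)
      (fun n => hh.mul (hmeas0 _ (hχ n)))]
    · exact iSup_le fun n => hx _ (hχ n)
    · intro n
      filter_upwards [hχmono n] with ω a
      gcongr

namespace StableFamily

variable {m0 : MeasurableSpace Ω} {μ : Measure Ω} [IsFiniteMeasure μ] {T : ℝ}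
  {ℱ : Filtration ℝ m0} {K : Set (ℝ → Ω → ℝ)}

/-- The essential supremum of the conditional expectations of `g ρ` given `ℱ u`, over all ratios
`ρ` from time `u` to time `t`. -/
lemma exists_condSup (hK : StableFamily μ T ℱ K) {u t : ℝ} (hu : u ∈ Icc (0 : ℝ) T)
    (ht : t ∈ Icc (0 : ℝ) T) (hut : u ≤ t) {g : Ω → ℝ≥0∞} (hg : Measurable[ℱ t] g)
    (hg1 : ∀ ω, g ω ≤ 1) :
    ∃ J : Ω → ℝ≥0∞, Measurable[ℱ u] J ∧ (∀ ω, J ω ≤ 1) ∧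
      (∀ ρ ∈ ratioSet μ ℱ K u t, ∀ h : Ω → ℝ≥0∞, Measurable[ℱ u] h →
        ∫⁻ ω, h ω * (g ω * ρ ω) ∂μ ≤ ∫⁻ ω, h ω * J ω ∂μ) ∧
      ∀ h : Ω → ℝ≥0∞, Measurable[ℱ u] h → ∀ x,
        (∀ ρ ∈ ratioSet μ ℱ K u t, ∫⁻ ω, h ω * (g ω * ρ ω) ∂μ ≤ x) →
          ∫⁻ ω, h ω * J ω ∂μ ≤ x := by
  have hgρ : ∀ ρ ∈ ratioSet μ ℱ K u t, AEMeasurable (fun ω => g ω * ρ ω) μ := fun ρ hρ =>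
    ((hg.mul hρ.1).mono (ℱ.le t) le_rfl).aemeasurable
  have hcond : ∀ ρ ∈ ratioSet μ ℱ K u t, ∀ h : Ω → ℝ≥0∞, Measurable[ℱ u] h →
      ∫⁻ ω, h ω * condLExp (ℱ u) μ (fun ω => g ω * ρ ω) ω ∂μ = ∫⁻ ω, h ω * (g ω * ρ ω) ∂μ :=
    fun ρ hρ h hh => lintegral_mul_condLExp (ℱ.le u) (hgρ ρ hρ) hh
  have key := exists_ae_sup_of_directed (μ := μ) (ℱ.le u)
    (Φ := (fun ρ => condLExp (ℱ u) μ (fun ω => g ω * ρ ω)) '' ratioSet μ ℱ K u t)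
    ?_ ?_ ?_ ?_
  · obtain ⟨J, hJm, hJ1, hJge, hJle⟩ := key
    refine ⟨J, hJm, hJ1, fun ρ hρ h hh => ?_, fun h hh x hx => ?_⟩
    · rw [← hcond ρ hρ h hh]
      refine lintegral_mono_ae ?_
      filter_upwards [hJge _ ⟨ρ, hρ, rfl⟩] with ω h
      gcongr
    · refine hJle h (hh.mono (ℱ.le u) le_rfl) x ?_
      rintro _ ⟨ρ, hρ, rfl⟩
      rw [hcond ρ hρ h hh]
      exact hx ρ hρ
  · obtain ⟨Z, hZ, -⟩ := hK.far
    obtain ⟨ρ, hρ, -⟩ := hK.exists_ratio_ge hu ht hut hZ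
    exact ⟨_, ρ, hρ, rfl⟩
  · rintro _ ⟨ρ, hρ, rfl⟩
    exact measurable_condLExp _ _ _
  · rintro _ ⟨ρ, hρ, rfl⟩
    refine ae_le_of_ae_le_trim (hm := ℱ.le u) (f₂ := fun _ => (1 : ℝ≥0∞)) ?_
    refine ae_le_of_forall_setLIntegral_le_of_sigmaFinite (measurable_condLExp _ _ _)
      fun A hA _ => ?_
    rw [setLIntegral_condLExp_trim _ _ _ hA, setLIntegral_trim _ measurable_const hA]
    have h1 := hK.lintegral_ratio_le hu ht hut hρ (h := A.indicator fun _ => 1)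
      (Measurable.indicator measurable_const hA)
    calc ∫⁻ ω in A, g ω * ρ ω ∂μ ≤ ∫⁻ ω in A, ρ ω ∂μ :=
          lintegral_mono fun ω => mul_le_of_le_one_left zero_le (hg1 ω)
      _ = ∫⁻ ω, A.indicator (fun _ => 1) ω * ρ ω ∂μ := by
          rw [← lintegral_indicator (ℱ.le u A hA)]
          exact lintegral_congr fun ω => by by_cases h : ω ∈ A <;> simp [h]
      _ ≤ _ := h1
      _ = _ := lintegral_indicator (ℱ.le u A hA) _
  · rintro _ ⟨ρ₁, h₁, rfl⟩ _ ⟨ρ₂, h₂, rfl⟩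
    set φ₁ := condLExp (ℱ u) μ (fun ω => g ω * ρ₁ ω) with hφ₁
    set φ₂ := condLExp (ℱ u) μ (fun ω => g ω * ρ₂ ω) with hφ₂
    have m₁ : Measurable[ℱ u] φ₁ := measurable_condLExp _ _ _
    have m₂ : Measurable[ℱ u] φ₂ := measurable_condLExp _ _ _
    classical
    obtain ⟨A, hAdef⟩ : ∃ A : Set Ω, ∀ ω, ω ∈ A ↔ φ₂ ω ≤ φ₁ ω :=
      ⟨{ω | φ₂ ω ≤ φ₁ ω}, fun _ => Iff.rfl⟩
    have hA : MeasurableSet[ℱ u] A := by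
      have : A = {ω | φ₂ ω ≤ φ₁ ω} := by ext ω; simp [hAdef]
      rw [this]
      exact measurableSet_le_of_measurable m₂ m₁
    have hmix := hK.mix_mem_ratioSet hu ht hut h₁ h₂ (h := A.indicator fun _ => 1)
      (stronglyMeasurable_const.indicator hA)
      (fun ω => indicator_nonneg (fun _ _ => zero_le_one) ω)
      (fun ω => indicator_le_self' (fun _ _ => zero_le_one) ω)
    set ρ : Ω → ℝ≥0∞ := fun ω => ENNReal.ofReal (A.indicator (fun _ => 1) ω) * ρ₁ ω +
      ENNReal.ofReal (1 - A.indicator (fun _ => 1) ω) * ρ₂ ω with hρ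
    refine ⟨_, ⟨ρ, hmix, rfl⟩, ?_⟩
    have hmax : (fun ω => max (φ₁ ω) (φ₂ ω)) =ᵐ[μ] condLExp (ℱ u) μ (fun ω => g ω * ρ ω) := by
      refine ae_eq_condLExp (ℱ.le u) μ _ (m₁.max m₂) fun B hB => ?_
      have i₁ : Measurable[ℱ u] ((B ∩ A).indicator fun _ => (1 : ℝ≥0∞)) :=
        Measurable.indicator measurable_const (hB.inter hA)
      have i₂ : Measurable[ℱ u] ((B \ A).indicator fun _ => (1 : ℝ≥0∞)) :=
        Measurable.indicator measurable_const (hB.diff hA)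
      have e₁ := hcond ρ₁ h₁ _ i₁
      have e₂ := hcond ρ₂ h₂ _ i₂
      rw [← lintegral_indicator (ℱ.le u B hB), ← lintegral_indicator (ℱ.le u B hB)]
      have l : ∫⁻ ω, B.indicator (fun ω => max (φ₁ ω) (φ₂ ω)) ω ∂μ =
          ∫⁻ ω, (B ∩ A).indicator (fun _ => (1 : ℝ≥0∞)) ω * φ₁ ω ∂μ +
            ∫⁻ ω, (B \ A).indicator (fun _ => (1 : ℝ≥0∞)) ω * φ₂ ω ∂μ := by
        rw [← lintegral_add_left (f := fun ω => (B ∩ A).indicator (fun _ => (1 : ℝ≥0∞)) ω * φ₁ ω)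
            ((i₁.mul m₁).mono (ℱ.le u) le_rfl)]
        refine lintegral_congr fun ω => ?_
        by_cases hb : ω ∈ B
        · by_cases ha : ω ∈ A
          · simp [ha, hb, (hAdef ω).1 ha]
          · simp [ha, hb, (not_le.1 fun h => ha ((hAdef ω).2 h)).le]
        · simp [hb]
      have r : ∫⁻ ω, B.indicator (fun ω => g ω * ρ ω) ω ∂μ =
          ∫⁻ ω, (B ∩ A).indicator (fun _ => (1 : ℝ≥0∞)) ω * (g ω * ρ₁ ω) ∂μ +
            ∫⁻ ω, (B \ A).indicator (fun _ => (1 : ℝ≥0∞)) ω * (g ω * ρ₂ ω) ∂μ := by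
        rw [← lintegral_add_left'
            (f := fun ω => (B ∩ A).indicator (fun _ => (1 : ℝ≥0∞)) ω * (g ω * ρ₁ ω))
            ((i₁.mono (ℱ.le u) le_rfl).aemeasurable.mul (hgρ ρ₁ h₁))]
        refine lintegral_congr fun ω => ?_
        by_cases hb : ω ∈ B
        · by_cases ha : ω ∈ A <;> simp [ha, hb, hρ]
        · simp [hb]
      rw [l, r, ← e₁, ← e₂]
    constructor
    · filter_upwards [hmax] with ω h
      rw [← h]
      exact le_max_left _ _
    · filter_upwards [hmax] with ω h
      rw [← h]
      exact le_max_right _ _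

/-- A family `J` of random variables with values in `[0,1]`, ending in `g` at time `t`, such that
`J Z` satisfies the supermartingale inequality on `[0,t]` for all `Z ∈ K`. -/
lemma exists_condSup_family (hK : StableFamily μ T ℱ K) {t : ℝ}
    (ht : t ∈ Icc (0 : ℝ) T) {g : Ω → ℝ≥0∞} (hg : Measurable[ℱ t] g) (hg1 : ∀ ω, g ω ≤ 1) :
    ∃ J : ℝ → Ω → ℝ≥0∞, (∀ u ∈ Icc 0 t, Measurable[ℱ u] (J u)) ∧ (∀ u ω, J u ω ≤ 1) ∧
      J t = g ∧
      (∀ Z ∈ K, ∀ u v, 0 ≤ u → u ≤ v → v ≤ t → ∀ h : Ω → ℝ≥0∞, Measurable[ℱ u] h →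
        ∫⁻ ω, h ω * (J v ω * ENNReal.ofReal (Z v ω)) ∂μ ≤
          ∫⁻ ω, h ω * (J u ω * ENNReal.ofReal (Z u ω)) ∂μ) ∧
      ∀ u, 0 ≤ u → u < t → ∀ x,
        (∀ ρ ∈ ratioSet μ ℱ K u t, ∫⁻ ω, g ω * ρ ω ∂μ ≤ x) → ∫⁻ ω, J u ω ∂μ ≤ x := by
  have hmem : ∀ {u}, 0 ≤ u → u ≤ t → u ∈ Icc (0 : ℝ) T := fun h0 h1 => ⟨h0, h1.trans ht.2⟩
  have hex : ∀ u, ∃ J : Ω → ℝ≥0∞, 0 ≤ u → u ≤ t → Measurable[ℱ u] J ∧ (∀ ω, J ω ≤ 1) ∧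
      (∀ ρ ∈ ratioSet μ ℱ K u t, ∀ h : Ω → ℝ≥0∞, Measurable[ℱ u] h →
        ∫⁻ ω, h ω * (g ω * ρ ω) ∂μ ≤ ∫⁻ ω, h ω * J ω ∂μ) ∧
      ∀ h : Ω → ℝ≥0∞, Measurable[ℱ u] h → ∀ x,
        (∀ ρ ∈ ratioSet μ ℱ K u t, ∫⁻ ω, h ω * (g ω * ρ ω) ∂μ ≤ x) →
          ∫⁻ ω, h ω * J ω ∂μ ≤ x := by
    intro u
    by_cases h : 0 ≤ u ∧ u ≤ t
    · obtain ⟨J, hJ⟩ := hK.exists_condSup (hmem h.1 h.2) ht h.2 hg hg1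
      exact ⟨J, fun _ _ => hJ⟩
    · exact ⟨0, fun h0 h1 => absurd ⟨h0, h1⟩ h⟩
  choose L hL using hex
  set J : ℝ → Ω → ℝ≥0∞ := fun u => if u = t then g else fun ω => min (L u ω) 1 with hJ
  have hJt : J t = g := by simp [hJ]
  have hJL : ∀ u, 0 ≤ u → u < t → J u = L u := by
    intro u h0 h1
    ext ω
    simp [hJ, h1.ne, (hL u h0 h1.le).2.1 ω]
  have hJm : ∀ u ∈ Icc 0 t, Measurable[ℱ u] (J u) := by
    intro u hu
    rcases hu.2.eq_or_lt with rfl | h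
    · rwa [hJt]
    · rw [hJL u hu.1 h]
      exact (hL u hu.1 h.le).1
  have hmain : ∀ Z ∈ K, ∀ u, 0 ≤ u → u < t → ∀ h : Ω → ℝ≥0∞, Measurable[ℱ u] h →
      ∫⁻ ω, h ω * (g ω * ENNReal.ofReal (Z t ω)) ∂μ ≤
        ∫⁻ ω, h ω * (J u ω * ENNReal.ofReal (Z u ω)) ∂μ := by
    intro Z hZ u h0 h1 h hh
    obtain ⟨ρ, hρ, hle⟩ := hK.exists_ratio_ge (hmem h0 h1.le) ht h1.le hZ
    rw [hJL u h0 h1]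
    calc ∫⁻ ω, h ω * (g ω * ENNReal.ofReal (Z t ω)) ∂μ
        ≤ ∫⁻ ω, (h ω * ENNReal.ofReal (Z u ω)) * (g ω * ρ ω) ∂μ := by
          refine lintegral_mono_ae ?_
          filter_upwards [hle] with ω e
          calc h ω * (g ω * ENNReal.ofReal (Z t ω))
              ≤ h ω * (g ω * (ENNReal.ofReal (Z u ω) * ρ ω)) := by gcongr
            _ = _ := by ring
      _ ≤ ∫⁻ ω, (h ω * ENNReal.ofReal (Z u ω)) * L u ω ∂μ :=
          (hL u h0 h1.le).2.2.1 ρ hρ _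
            (hh.mul ((hK.s1mem Z hZ).1.1.measurable_ofReal (hmem h0 h1.le)))
      _ = _ := lintegral_congr fun ω => by ring
  refine ⟨J, hJm, fun u ω => ?_, hJt, fun Z hZ u v h0 huv hvt h hh => ?_, fun u h0 h1 x hx => ?_⟩
  · by_cases h : u = t
    · simpa [hJ, h] using hg1 ω
    · simp [hJ, h]
  · rcases huv.eq_or_lt with rfl | huv
    · exact le_rfl
    rcases hvt.eq_or_lt with rfl | hvt
    · rw [hJt]
      exact hmain Z hZ u h0 huv h hh
    have hv0 := h0.trans huv.le
    have hZm := (hK.s1mem Z hZ).1.1.measurable_ofReal (hmem hv0 hvt.le)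
    calc ∫⁻ ω, h ω * (J v ω * ENNReal.ofReal (Z v ω)) ∂μ
        = ∫⁻ ω, (h ω * ENNReal.ofReal (Z v ω)) * L v ω ∂μ := by
          rw [hJL v hv0 hvt]
          exact lintegral_congr fun ω => by ring
      _ ≤ ∫⁻ ω, h ω * (J u ω * ENNReal.ofReal (Z u ω)) ∂μ := by
          refine (hL v hv0 hvt.le).2.2.2 (fun ω => h ω * ENNReal.ofReal (Z v ω))
            ((hh.mono (ℱ.mono huv.le) le_rfl).mul hZm) _
            fun ρ hρ => ?_
          obtain ⟨Z', hZ', hlt, -, heq⟩ := hK.exists_concat (hmem hv0 hvt.le) hvt.le hZ hρ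
          have := hmain Z' hZ' u h0 (huv.trans hvt) h hh
          rw [hlt u huv] at this
          refine le_trans (lintegral_mono_ae ?_) this
          filter_upwards [heq] with ω e
          rw [e]
          exact le_of_eq (by ring)
  · rw [hJL u h0 h1]
    simpa using (hL u h0 h1.le).2.2.2 (fun _ => 1) measurable_const x (by simpa using hx)

end StableFamily

/-- `CrossChain D f a b m y`: below `y`, the restriction of `f` to `D` crosses from below `a` to
above `b` at least `m` times. -/
def CrossChain (D : Set ℝ) (f : ℝ → ℝ) (a b : ℝ) : ℕ → ℝ → Prop
  | 0, _ => True
  | m + 1, y => ∃ d₁ ∈ D, ∃ d₂ ∈ D, d₁ < d₂ ∧ d₂ < y ∧ f d₁ < a ∧ b < f d₂ ∧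
      CrossChain D f a b m d₁

namespace CrossChain

variable {D : Set ℝ} {f : ℝ → ℝ} {a b : ℝ}

lemma mono_right {m : ℕ} {x y : ℝ} (hxy : x ≤ y) (h : CrossChain D f a b m x) :
    CrossChain D f a b m y := by
  cases m with
  | zero => trivial
  | succ m =>
    obtain ⟨d₁, h₁, d₂, h₂, h12, h2, ha, hb, h⟩ := h
    exact ⟨d₁, h₁, d₂, h₂, h12, h2.trans_le hxy, ha, hb, h⟩

lemma mono_left {D' : Set ℝ} (hD : D ⊆ D') {m : ℕ} {x : ℝ} (h : CrossChain D f a b m x) :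
    CrossChain D' f a b m x := by
  induction m generalizing x with
  | zero => trivial
  | succ m ih =>
    obtain ⟨d₁, h₁, d₂, h₂, h12, h2, ha, hb, h⟩ := h
    exact ⟨d₁, hD h₁, d₂, hD h₂, h12, h2, ha, hb, ih h⟩

lemma exists_of_iUnion {E : ℕ → Set ℝ} (hE : Monotone E) {m : ℕ} {x : ℝ}
    (h : CrossChain (⋃ k, E k) f a b m x) : ∃ k, CrossChain (E k) f a b m x := by
  induction m generalizing x with
  | zero => exact ⟨0, trivial⟩
  | succ m ih =>
    obtain ⟨d₁, h₁, d₂, h₂, h12, h2, ha, hb, h⟩ := h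
    obtain ⟨k, hk⟩ := ih h
    obtain ⟨i, hi⟩ := mem_iUnion.1 h₁
    obtain ⟨j, hj⟩ := mem_iUnion.1 h₂
    refine ⟨max k (max i j), d₁, hE ?_ hi, d₂, hE ?_ hj, h12, h2, ha, hb, hk.mono_left (hE ?_)⟩ <;>
    simp

lemma of_frequently_right {u : ℝ} (ha : ∃ᶠ d in 𝓝[>] u ⊓ 𝓟 D, f d < a)
    (hb : ∃ᶠ d in 𝓝[>] u ⊓ 𝓟 D, b < f d) (m : ℕ) {y : ℝ} (hy : u < y) :
    CrossChain D f a b m y := by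
  have key : ∀ z, u < z → ∀ᶠ d in 𝓝[>] u ⊓ 𝓟 D, d ∈ D ∧ u < d ∧ d < z := fun z hz => by
    rw [eventually_inf_principal]
    filter_upwards [Ioo_mem_nhdsGT hz] with d h hd using ⟨hd, h⟩
  induction m generalizing y with
  | zero => trivial
  | succ m ih =>
    obtain ⟨d₂, hd₂, h₂, hu₂, hy₂⟩ := (hb.and_eventually (key y hy)).exists
    obtain ⟨d₁, hd₁, h₁, hu₁, hy₁⟩ := (ha.and_eventually (key d₂ hu₂)).exists
    exact ⟨d₁, h₁, d₂, h₂, hy₁, hy₂, hd₁, hd₂, ih hu₁⟩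

lemma of_frequently_left {u : ℝ} (ha : ∃ᶠ d in 𝓝[<] u ⊓ 𝓟 D, f d < a)
    (hb : ∃ᶠ d in 𝓝[<] u ⊓ 𝓟 D, b < f d) (m : ℕ) : CrossChain D f a b m u := by
  have key : ∀ z, z < u → ∀ᶠ d in 𝓝[<] u ⊓ 𝓟 D, d ∈ D ∧ z < d ∧ d < u := fun z hz => by
    rw [eventually_inf_principal]
    filter_upwards [Ioo_mem_nhdsLT hz] with d h hd using ⟨hd, h⟩
  suffices ∃ y < u, CrossChain D f a b m y by
    obtain ⟨y, hy, h⟩ := this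
    exact h.mono_right hy.le
  induction m with
  | zero => exact ⟨u - 1, by linarith, trivial⟩
  | succ m ih =>
    obtain ⟨y, hy, h⟩ := ih
    obtain ⟨d₁, hd₁, h₁, hu₁, hy₁⟩ := (ha.and_eventually (key y hy)).exists
    obtain ⟨d₂, hd₂, h₂, hu₂, hy₂⟩ := (hb.and_eventually (key d₁ hy₁)).exists
    obtain ⟨z, hz, hzu⟩ := exists_between hy₂
    exact ⟨z, hzu, d₁, h₁, d₂, h₂, hu₂, hz, hd₁, hd₂, h.mono_right hu₁.le⟩

lemma le_upcrossingsBefore {τ : ℕ → ℝ} (hτ : Monotone τ) {W : ℝ → Ω → ℝ} {ω : Ω} (hab : a < b)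
    {m N : ℕ} {y : ℝ} (hN : ∀ i, τ i < y → ∃ j < N, τ j = τ i)
    (h : CrossChain (range τ) (fun u => W u ω) a b m y) :
    m ≤ upcrossingsBefore a b (fun n => W (τ n)) N ω := by
  induction m generalizing y N with
  | zero => exact Nat.zero_le _
  | succ m ih =>
    obtain ⟨_, ⟨i, rfl⟩, _, ⟨j, rfl⟩, h12, h2, ha, hb, h⟩ := h
    obtain ⟨j', hj', hjj⟩ := hN j h2
    have hm := ih (y := τ i) (N := i) (fun k hk => ⟨k, hτ.reflect_lt hk, rfl⟩) h
    rw [← hjj] at h12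
    simp only [← hjj] at hb
    have hij := (hτ.reflect_lt h12).le
    calc m + 1 ≤ upcrossingsBefore a b (fun n => W (τ n)) i ω + 1 := by omega
      _ ≤ upcrossingsBefore a b (fun n => W (τ n)) (j' + 1) ω :=
        upcrossingsBefore_lt_of_exists_upcrossing hab le_rfl ha hij hb
      _ ≤ _ := upcrossingsBefore_mono hab (show j' + 1 ≤ N from hj') ω

end CrossChain

/-- A function without arbitrarily long chains of crossings has limits along `D`. -/
lemma exists_tendsto_right_of_not_crossChain {D : Set ℝ} {f : ℝ → ℝ} {u y : ℝ} (hy : u < y)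
    (hH : ∀ a b : ℚ, (a : ℝ) < b → ∃ m, ¬ CrossChain D f a b m y)
    (h : (𝓝[>] u ⊓ 𝓟 D).IsBoundedUnder (· ≤ ·) f)
    (h' : (𝓝[>] u ⊓ 𝓟 D).IsBoundedUnder (· ≥ ·) f) :
    ∃ c, Tendsto f (𝓝[>] u ⊓ 𝓟 D) (𝓝 c) := by
  refine tendsto_of_no_upcrossings Rat.denseRange_cast ?_ h h'
  rintro _ ⟨a, rfl⟩ _ ⟨b, rfl⟩ hab ⟨ha, hb⟩
  obtain ⟨m, hm⟩ := hH a b hab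
  exact hm (CrossChain.of_frequently_right ha hb m hy)

lemma exists_tendsto_left_of_not_crossChain {D : Set ℝ} {f : ℝ → ℝ} {u y : ℝ} (hy : u ≤ y)
    (hH : ∀ a b : ℚ, (a : ℝ) < b → ∃ m, ¬ CrossChain D f a b m y)
    (h : (𝓝[<] u ⊓ 𝓟 D).IsBoundedUnder (· ≤ ·) f)
    (h' : (𝓝[<] u ⊓ 𝓟 D).IsBoundedUnder (· ≥ ·) f) :
    ∃ c, Tendsto f (𝓝[<] u ⊓ 𝓟 D) (𝓝 c) := by
  refine tendsto_of_no_upcrossings Rat.denseRange_cast ?_ h h'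
  rintro _ ⟨a, rfl⟩ _ ⟨b, rfl⟩ hab ⟨ha, hb⟩
  obtain ⟨m, hm⟩ := hH a b hab
  exact hm ((CrossChain.of_frequently_left ha hb m).mono_right hy)

lemma tendsto_of_eventually_tendsto_seq {D S : Set ℝ} (hS : IsOpen S) {f R : ℝ → ℝ} {u c : ℝ}
    (hf : Tendsto f (𝓝[S] u ⊓ 𝓟 D) (𝓝 c)) {d : ℕ → ℝ → ℝ}
    (hR : ∀ᶠ v in 𝓝[S] u, Tendsto (fun n => d n v) atTop (𝓝 v) ∧
      (∀ n, d n v ∈ D) ∧ Tendsto (fun n => f (d n v)) atTop (𝓝 (R v))) :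
    Tendsto R (𝓝[S] u) (𝓝 c) := by
  refine (closed_nhds_basis c).tendsto_right_iff.2 fun V hV => ?_
  have h1 : ∀ᶠ x in 𝓝[S] u, x ∈ D → f x ∈ V := by
    rw [← eventually_inf_principal]
    exact hf hV.1
  filter_upwards [eventually_eventually_nhdsWithin.2 h1, hR, self_mem_nhdsWithin] with v h2 h3 hv
  rw [hS.nhdsWithin_eq hv] at h2
  refine hV.2.mem_of_tendsto h3.2.2 ?_
  filter_upwards [h3.1.eventually h2] with n hn using hn (h3.2.1 n)

/-- The dyadic grid of mesh `2⁻ᵏ`, stopped at `t`. -/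
noncomputable def stoppedGrid (t : ℝ) (k n : ℕ) : ℝ := min (n / 2 ^ k) t

/-- The first point of the dyadic grid of mesh `2⁻ᵏ` strictly to the right of `u`, stopped
at `t`. -/
noncomputable def nextGrid (t : ℝ) (k : ℕ) (u : ℝ) : ℝ := stoppedGrid t k (⌊2 ^ k * u⌋₊ + 1)

/-- All dyadic numbers, stopped at `t`. -/
def gridSet (t : ℝ) : Set ℝ := ⋃ k, range (stoppedGrid t k)

lemma stoppedGrid_mono (t : ℝ) (k : ℕ) : Monotone (stoppedGrid t k) := fun i j hij => by
  have : (i : ℝ) ≤ j := by exact_mod_cast hij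
  unfold stoppedGrid
  gcongr

lemma range_stoppedGrid_mono (t : ℝ) : Monotone fun k => range (stoppedGrid t k) := by
  refine monotone_nat_of_le_succ fun k => ?_
  rintro _ ⟨n, rfl⟩
  refine ⟨2 * n, ?_⟩
  unfold stoppedGrid
  congr 1
  push_cast
  rw [pow_succ]
  field_simp

lemma stoppedGrid_mem_Icc {t : ℝ} (ht : 0 ≤ t) (k n : ℕ) : stoppedGrid t k n ∈ Icc 0 t :=
  ⟨le_min (by positivity) ht, min_le_right _ _⟩

lemma gridSet_subset {t : ℝ} (ht : 0 ≤ t) : gridSet t ⊆ Icc 0 t := by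
  refine iUnion_subset fun k => ?_
  rintro _ ⟨n, rfl⟩
  exact stoppedGrid_mem_Icc ht k n

lemma exists_stoppedGrid_eq {t : ℝ} (k : ℕ) :
    ∃ N : ℕ, ∀ i, ∃ j < N, stoppedGrid t k j = stoppedGrid t k i := by
  refine ⟨⌈t * 2 ^ k⌉₊ + 1, fun i => ?_⟩
  rcases le_total i ⌈t * 2 ^ k⌉₊ with h | h
  · exact ⟨i, by omega, rfl⟩
  · refine ⟨_, Nat.lt_succ_self _, ?_⟩
    have key : ∀ j : ℕ, ⌈t * 2 ^ k⌉₊ ≤ j → stoppedGrid t k j = t := fun j hj => by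
      refine min_eq_right ?_
      rw [le_div_iff₀ (by positivity)]
      exact (Nat.le_ceil _).trans (by exact_mod_cast hj)
    rw [key _ le_rfl, key _ h]

lemma nextGrid_mem (t : ℝ) (k : ℕ) (u : ℝ) : nextGrid t k u ∈ gridSet t :=
  mem_iUnion.2 ⟨k, _, rfl⟩

lemma lt_nextGrid {t : ℝ} (k : ℕ) {u : ℝ} (hut : u < t) : u < nextGrid t k u := by
  refine lt_min ?_ hut
  rw [lt_div_iff₀ (by positivity), mul_comm]
  exact_mod_cast Nat.lt_floor_add_one _

lemma nextGrid_le {t : ℝ} (k : ℕ) {u : ℝ} (h0 : 0 ≤ u) : nextGrid t k u ≤ u + (1 / 2) ^ k := by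
  refine (min_le_left _ _).trans ?_
  rw [div_le_iff₀ (by positivity)]
  have := Nat.floor_le (show 0 ≤ 2 ^ k * u by positivity)
  have e : (u + (1 / 2) ^ k) * (2 : ℝ) ^ k = 2 ^ k * u + 1 := by
    rw [add_mul, ← mul_pow]
    norm_num
    ring
  rw [e]
  push_cast
  linarith

lemma tendsto_nextGrid {t : ℝ} {u : ℝ} (h0 : 0 ≤ u) (hut : u < t) :
    Tendsto (fun k => nextGrid t k u) atTop (𝓝 u) := by
  refine tendsto_of_tendsto_of_tendsto_of_le_of_le tendsto_const_nhds ?_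
    (fun k => (lt_nextGrid k hut).le) (fun k => nextGrid_le k h0)
  simpa using tendsto_const_nhds.add
    (tendsto_pow_atTop_nhds_zero_of_lt_one (by norm_num : (0 : ℝ) ≤ 1 / 2) (by norm_num))

lemma tendsto_nextGrid_right {t : ℝ} {u : ℝ} (h0 : 0 ≤ u) (hut : u < t) :
    Tendsto (fun k => nextGrid t k u) atTop (𝓝[>] u ⊓ 𝓟 (gridSet t)) := by
  refine tendsto_inf.2 ⟨tendsto_nhdsWithin_iff.2 ⟨tendsto_nextGrid h0 hut, ?_⟩, ?_⟩
  · exact Eventually.of_forall fun k => lt_nextGrid k hut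
  · exact tendsto_principal.2 (Eventually.of_forall fun k => nextGrid_mem t k u)

/-- A nonnegative supermartingale that is positive at time `t` is bounded away from zero along
the dyadic grid up to `t`. -/
lemma SuperMG.ae_exists_gridSet_le {m0 : MeasurableSpace Ω} {μ : Measure Ω} [IsProbabilityMeasure μ]
    {T : ℝ} {ℱ : Filtration ℝ m0} {X : ℝ → Ω → ℝ} (hX : SuperMG μ T ℱ X) {t : ℝ}
    (ht : t ∈ Icc (0 : ℝ) T) (hpos : ∀ᵐ ω ∂μ, 0 < X t ω) :
    ∀ᵐ ω ∂μ, ∃ ε > 0, ∀ d ∈ gridSet t, ε ≤ X d ω := by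
  have hτ : ∀ k n, stoppedGrid t k n ∈ Icc (0 : ℝ) T := fun k n =>
    ⟨(stoppedGrid_mem_Icc ht.1 k n).1, (stoppedGrid_mem_Icc ht.1 k n).2.trans ht.2⟩
  let E : ℝ → ℕ → Set Ω := fun ε k => ⋃ n, {ω | X (stoppedGrid t k n) ω < ε}
  have hE : ∀ ε, Monotone (E ε) := by
    intro ε k l hkl
    refine iUnion_subset fun n ω hω => ?_
    obtain ⟨j, hj⟩ := range_stoppedGrid_mono t hkl ⟨n, rfl⟩
    exact mem_iUnion.2 ⟨j, by rw [hj]; exact hω⟩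
  have hEk : ∀ ε k, ∫⁻ ω in E ε k, ENNReal.ofReal (X t ω) ∂μ ≤ ENNReal.ofReal ε := by
    intro ε k
    obtain ⟨A, hA⟩ : ∃ A : ℕ → Set Ω, A = fun n => {ω | X (stoppedGrid t k n) ω < ε} := ⟨_, rfl⟩
    have hAm : ∀ n, MeasurableSet[ℱ (stoppedGrid t k n)] (A n) := fun n => by
      have : A n = X (stoppedGrid t k n) ⁻¹' Iio ε := by rw [hA]; rfl
      rw [this]
      exact (hX.1.1 _ (hτ k n)).measurable measurableSet_Iio
    have hBm : ∀ n, MeasurableSet[ℱ (stoppedGrid t k n)] (disjointed A n) := fun n => by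
      rw [disjointed_eq_inter_compl]
      refine (hAm n).inter (MeasurableSet.iInter fun j => MeasurableSet.iInter fun hj => ?_)
      exact (ℱ.mono (stoppedGrid_mono t k hj.le) _ (hAm j)).compl
    have hBm0 : ∀ n, MeasurableSet (disjointed A n) := fun n => ℱ.le _ _ (hBm n)
    have hEA : E ε k = ⋃ n, disjointed A n := by rw [iUnion_disjointed, hA]
    rw [hEA, lintegral_iUnion hBm0 (disjoint_disjointed A)]
    calc ∑' n, ∫⁻ ω in disjointed A n, ENNReal.ofReal (X t ω) ∂μ
        ≤ ∑' n, ENNReal.ofReal ε * μ (disjointed A n) := by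
          refine ENNReal.tsum_le_tsum fun n => ?_
          have := hX.lintegral_mul_le (hτ k n) ht (stoppedGrid_mem_Icc ht.1 k n).2
            (h := (disjointed A n).indicator fun _ => 1)
            (Measurable.indicator measurable_const (hBm n))
          have e : ∀ f : Ω → ℝ≥0∞, ∫⁻ ω, (disjointed A n).indicator (fun _ => 1) ω * f ω ∂μ =
              ∫⁻ ω in disjointed A n, f ω ∂μ := fun f => by
            rw [← lintegral_indicator (hBm0 n)]
            exact lintegral_congr fun ω => by by_cases h : ω ∈ disjointed A n <;> simp [h]
          rw [e, e] at this
          refine this.trans ?_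
          rw [← setLIntegral_const]
          refine setLIntegral_mono' (hBm0 n) fun ω hω => ENNReal.ofReal_le_ofReal ?_
          have : ω ∈ A n := disjointed_subset A n hω
          rw [hA] at this
          exact le_of_lt this
      _ = ENNReal.ofReal ε * μ (⋃ n, disjointed A n) := by
          rw [ENNReal.tsum_mul_left, measure_iUnion (disjoint_disjointed A) hBm0]
      _ ≤ ENNReal.ofReal ε := mul_le_of_le_one_right zero_le prob_le_one
  have hEu : ∀ ε, ∫⁻ ω in ⋃ k, E ε k, ENNReal.ofReal (X t ω) ∂μ ≤ ENNReal.ofReal ε := fun ε => by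
    rw [setLIntegral_iUnion_of_directed _ (hE ε).directed_le]
    exact iSup_le (hEk ε)
  let B : Set Ω := {ω | ∀ ε > 0, ∃ d ∈ gridSet t, X d ω < ε}
  have hBsub : ∀ ε > 0, B ⊆ ⋃ k, E ε k := by
    intro ε hε ω hω
    obtain ⟨d, hd, hlt⟩ := hω ε hε
    obtain ⟨k, n, rfl⟩ := mem_iUnion.1 hd
    exact mem_iUnion.2 ⟨k, mem_iUnion.2 ⟨n, hlt⟩⟩
  have hB0 : ∫⁻ ω in B, ENNReal.ofReal (X t ω) ∂μ = 0 := by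
    refine le_antisymm (ENNReal.le_of_forall_pos_le_add fun ε hε _ => ?_) zero_le
    refine (lintegral_mono_set (hBsub ε hε)).trans ((hEu ε).trans ?_)
    simp
  rw [lintegral_eq_zero_iff (hX.1.measurable_ofReal' ht)] at hB0
  have hμB : μ B = 0 := by
    have hpos' := ae_restrict_of_ae (s := B) hpos
    have : ∀ᵐ ω ∂(μ.restrict B), False := by
      filter_upwards [hB0, hpos'] with ω h1 h2
      simp only [Pi.zero_apply, ENNReal.ofReal_eq_zero] at h1
      exact h2.not_ge h1
    simpa using this
  filter_upwards [measure_eq_zero_iff_ae_notMem.1 hμB] with ω hω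
  simp only [B, mem_ofPred_eq] at hω
  push Not at hω
  exact hω

/-- A nonnegative supermartingale indexed by the reals almost surely has only finitely many
crossings of each rational interval along the dyadic grid. -/
lemma ae_exists_not_crossChain {m0 : MeasurableSpace Ω} {μ : Measure Ω} [IsProbabilityMeasure μ]
    {ℱ : Filtration ℝ m0} {V : ℝ → Ω → ℝ} {t : ℝ} (ht : 0 ≤ t)
    (hm : ∀ u ∈ Icc 0 t, StronglyMeasurable[ℱ u] (V u)) (hinte : ∀ u ∈ Icc 0 t, Integrable (V u) μ)
    (h0 : ∀ u ∈ Icc 0 t, 0 ≤ᵐ[μ] V u)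
    (hV : ∀ u ∈ Icc 0 t, ∀ v ∈ Icc 0 t, u ≤ v → μ[V v | ℱ u] ≤ᵐ[μ] V u) (y : ℝ) :
    ∀ᵐ ω ∂μ, ∀ a b : ℚ, (a : ℝ) < b →
      ∃ m, ¬ CrossChain (gridSet t) (fun u => -V u ω) a b m y := by
  refine ae_all_iff.2 fun a => ae_all_iff.2 fun b => ?_
  by_cases hab : (a : ℝ) < b
  swap
  · exact ae_of_all _ fun ω h => absurd h hab
  have hτ := stoppedGrid_mem_Icc ht
  set W : ℝ → Ω → ℝ := fun u ω => -V u ω with hW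
  let E : ℕ → ℕ → Set Ω := fun m k =>
    {ω | CrossChain (range (stoppedGrid t k)) (fun u => W u ω) a b m y}
  have hE : ∀ m, Monotone (E m) := fun m k l hkl ω hω =>
    CrossChain.mono_left (range_stoppedGrid_mono t hkl) hω
  have hEk : ∀ m k, μ (E (m + 1) k) ≤ ENNReal.ofReal (|(a : ℝ)| / (b - a) / (m + 1)) := by
    intro m k
    obtain ⟨N, hN⟩ := exists_stoppedGrid_eq (t := t) k
    let 𝒢 : Filtration ℕ m0 := ⟨fun n => ℱ (stoppedGrid t k n),
      fun i j hij => ℱ.mono (stoppedGrid_mono t k hij), fun n => ℱ.le _⟩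
    have hsub : Submartingale (fun n => W (stoppedGrid t k n)) 𝒢 μ := by
      have : Supermartingale (fun n => V (stoppedGrid t k n)) 𝒢 μ :=
        ⟨fun n => hm _ (hτ k n), fun i j hij => hV _ (hτ k i) _ (hτ k j) (stoppedGrid_mono t k hij),
          fun n => hinte _ (hτ k n)⟩
      exact this.neg
    have hup := hsub.mul_integral_upcrossingsBefore_le_integral_pos_part (a : ℝ) b N
    have hle : ∫ ω, (W (stoppedGrid t k N) ω - a)⁺ ∂μ ≤ |(a : ℝ)| := by
      have := integral_mono_of_nonneg (μ := μ) (f := fun ω => (W (stoppedGrid t k N) ω - a)⁺)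
        (g := fun _ => |(a : ℝ)|) (ae_of_all _ fun ω => posPart_nonneg _) (integrable_const _) ?_
      · simpa using this
      · filter_upwards [h0 _ (hτ k N)] with ω h
        have h : 0 ≤ V (stoppedGrid t k N) ω := h
        simp only [hW]
        refine sup_le ?_ (abs_nonneg _)
        linarith [neg_abs_le (a : ℝ)]
    have hmk := mul_meas_ge_le_integral_of_nonneg (μ := μ)
      (f := fun ω => (upcrossingsBefore (a : ℝ) b (fun n => W (stoppedGrid t k n)) N ω : ℝ))
      (ae_of_all _ fun ω => Nat.cast_nonneg _)
      (hsub.1.integrable_upcrossingsBefore hab) (m + 1)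
    have hba : 0 < (b : ℝ) - a := sub_pos.2 hab
    have hreal : μ.real {ω | (m + 1 : ℝ) ≤
        (upcrossingsBefore (a : ℝ) b (fun n => W (stoppedGrid t k n)) N ω : ℝ)} ≤
        |(a : ℝ)| / (b - a) / (m + 1) := by
      rw [le_div_iff₀ (by positivity), le_div_iff₀ hba]
      nlinarith [hup.trans hle]
    refine (measure_mono fun ω hω => ?_).trans
      ((ENNReal.le_ofReal_iff_toReal_le (measure_ne_top _ _) (by positivity)).2 hreal)
    have := CrossChain.le_upcrossingsBefore (stoppedGrid_mono t k) hab (N := N)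
      (fun i _ => hN i) hω
    exact_mod_cast this
  have hEu : ∀ m, μ (⋃ k, E (m + 1) k) ≤ ENNReal.ofReal (|(a : ℝ)| / (b - a) / (m + 1)) := by
    intro m
    rw [(hE (m + 1)).measure_iUnion]
    exact iSup_le (hEk m)
  have hzero : μ (⋂ m : ℕ, ⋃ k, E (m + 1) k) = 0 := by
    refine le_antisymm (ge_of_tendsto' (x := atTop) (f := fun m : ℕ =>
      ENNReal.ofReal (|(a : ℝ)| / (b - a) / (m + 1))) ?_ fun m =>
        (measure_mono (iInter_subset _ m)).trans (hEu m)) zero_le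
    rw [← ENNReal.ofReal_zero]
    exact ENNReal.tendsto_ofReal
      (tendsto_const_nhds.div_atTop (tendsto_natCast_atTop_atTop.atTop_add tendsto_const_nhds))
  filter_upwards [measure_eq_zero_iff_ae_notMem.1 hzero] with ω hω _
  simp only [mem_iInter, not_forall] at hω
  obtain ⟨m, hm⟩ := hω
  refine ⟨m + 1, fun h => hm ?_⟩
  obtain ⟨k, hk⟩ := CrossChain.exists_of_iUnion (range_stoppedGrid_mono t) h
  exact mem_iUnion.2 ⟨k, hk⟩

lemma exists_tendsto_of_mul {D : Set ℝ} {l : Filter ℝ} (hl : l ≤ 𝓟 D) {j z : ℝ → ℝ} {c ε : ℝ}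
    (hε : 0 < ε) (hz : Tendsto z l (𝓝 c)) (hzD : ∀ d ∈ D, ε ≤ z d) (hj0 : ∀ d, 0 ≤ j d)
    (hj1 : ∀ d, j d ≤ 1)
    (H : l.IsBoundedUnder (· ≤ ·) (fun u => -(j u * z u)) →
      l.IsBoundedUnder (· ≥ ·) (fun u => -(j u * z u)) →
      ∃ c, Tendsto (fun u => -(j u * z u)) l (𝓝 c)) :
    ∃ c, Tendsto j l (𝓝 c) := by
  rcases l.eq_or_neBot with rfl | hbot
  · exact ⟨0, tendsto_bot⟩
  have hD : ∀ᶠ d in l, ε ≤ z d := by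
    filter_upwards [hl (mem_principal_self D)] with d hd using hzD d hd
  have hc : ε ≤ c := ge_of_tendsto hz hD
  obtain ⟨M, hM⟩ := hz.isBoundedUnder_le
  rw [eventually_map] at hM
  obtain ⟨c', hc'⟩ := H ⟨0, by
      rw [eventually_map]
      filter_upwards [hD] with d hd
      have := mul_nonneg (hj0 d) (hε.le.trans hd)
      linarith⟩ ⟨-M, by
      rw [eventually_map]
      filter_upwards [hD, hM] with d hd hd'
      have := mul_le_of_le_one_left (hε.le.trans hd) (hj1 d)
      show -M ≤ _
      linarith⟩
  refine ⟨-c' / c, (hc'.neg.div hz (hε.trans_le hc).ne').congr' ?_⟩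
  filter_upwards [hD] with d hd
  have : z d ≠ 0 := (hε.trans_le hd).ne'
  simp [this]

/-- Fatou's lemma for almost surely convergent sequences. -/
lemma lintegral_le_of_ae_tendsto {m0 : MeasurableSpace Ω} {μ : Measure Ω} {f : ℕ → Ω → ℝ≥0∞}
    {g : Ω → ℝ≥0∞} (hf : ∀ n, AEMeasurable (f n) μ)
    (h : ∀ᵐ ω ∂μ, Tendsto (fun n => f n ω) atTop (𝓝 (g ω))) {c : ℝ≥0∞}
    (hc : ∀ᶠ n in atTop, ∫⁻ ω, f n ω ∂μ ≤ c) : ∫⁻ ω, g ω ∂μ ≤ c := by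
  calc ∫⁻ ω, g ω ∂μ = ∫⁻ ω, liminf (fun n => f n ω) atTop ∂μ :=
        lintegral_congr_ae (h.mono fun ω hω => hω.liminf_eq.symm)
    _ ≤ liminf (fun n => ∫⁻ ω, f n ω ∂μ) atTop := lintegral_liminf_le' hf
    _ ≤ liminf (fun _ => c) (atTop : Filter ℕ) := liminf_le_liminf hc
    _ = c := liminf_const c

lemma CadlagOn.mul {T : ℝ} {f g : ℝ → ℝ} (hf : CadlagOn T f) (hg : CadlagOn T g) :
    CadlagOn T fun u => f u * g u :=
  ⟨fun t ht => (hf.1 t ht).mul (hg.1 t ht), fun t ht => by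
    obtain ⟨a, ha⟩ := hf.2 t ht
    obtain ⟨b, hb⟩ := hg.2 t ht
    exact ⟨a * b, ha.mul hb⟩⟩

lemma PosProc.mul {m0 : MeasurableSpace Ω} {μ : Measure Ω} {T : ℝ} {ℱ : Filtration ℝ m0}
    {X Y : ℝ → Ω → ℝ} (hX : PosProc μ T ℱ X) (hY : PosProc μ T ℱ Y) :
    PosProc μ T ℱ fun t ω => X t ω * Y t ω := by
  refine ⟨fun t ht => (hX.1 t ht).mul (hY.1 t ht), ?_, ?_⟩
  · filter_upwards [hX.2.1, hY.2.1] with ω h1 h2 t ht using mul_nonneg (h1 t ht) (h2 t ht)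
  · filter_upwards [hX.2.2, hY.2.2] with ω h1 h2 using h1.mul h2

lemma measurable_of_rightCont {m0 : MeasurableSpace Ω} {ℱ : Filtration ℝ m0} {u : ℝ}
    (hrc : (ℱ u : MeasurableSpace Ω) = ⨅ (s : ℝ) (_ : u < s), ℱ s) {f : Ω → ℝ≥0∞}
    (hf : ∀ v, u < v → Measurable[ℱ v] f) : Measurable[ℱ u] f := by
  intro A hA
  rw [hrc]
  simp only [MeasurableSpace.measurableSet_iInf]
  exact fun v hv => hf v hv hA

namespace StableFamily

variable {m0 : MeasurableSpace Ω} {μ : Measure Ω} [IsProbabilityMeasure μ] {T : ℝ}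
  {ℱ : Filtration ℝ m0} {K : Set (ℝ → Ω → ℝ)}

lemma ae_exists_limits (hK : StableFamily μ T ℱ K) {t : ℝ} (ht : t ∈ Icc (0 : ℝ) T)
    {J : ℝ → Ω → ℝ≥0∞} (hJm : ∀ u ∈ Icc 0 t, Measurable[ℱ u] (J u)) (hJ1 : ∀ u ω, J u ω ≤ 1)
    (hJ : ∀ Z ∈ K, ∀ u v, 0 ≤ u → u ≤ v → v ≤ t → ∀ h : Ω → ℝ≥0∞, Measurable[ℱ u] h →
        ∫⁻ ω, h ω * (J v ω * ENNReal.ofReal (Z v ω)) ∂μ ≤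
          ∫⁻ ω, h ω * (J u ω * ENNReal.ofReal (Z u ω)) ∂μ) :
    ∀ᵐ ω ∂μ,
      (∀ u ∈ Ico 0 t, ∃ c, Tendsto (fun v => (J v ω).toReal) (𝓝[>] u ⊓ 𝓟 (gridSet t)) (𝓝 c)) ∧
      ∀ u ∈ Ioc 0 t, ∃ c, Tendsto (fun v => (J v ω).toReal) (𝓝[<] u ⊓ 𝓟 (gridSet t)) (𝓝 c) := by
  obtain ⟨Z, hZ, hpos⟩ := hK.exists_pos
  have hS := (hK.s1mem Z hZ).1
  have hT : ∀ u ∈ Icc 0 t, u ∈ Icc (0 : ℝ) T := fun u hu => ⟨hu.1, hu.2.trans ht.2⟩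
  have hr1 : ∀ u ω, (J u ω).toReal ≤ 1 := fun u ω => by
    simpa using ENNReal.toReal_mono ENNReal.one_ne_top (hJ1 u ω)
  have hVm : ∀ u ∈ Icc 0 t, StronglyMeasurable[ℱ u] fun ω => (J u ω).toReal * Z u ω := fun u hu =>
    (hJm u hu).ennreal_toReal.stronglyMeasurable.mul (hS.1.1 u (hT u hu))
  have hV0 : ∀ u ∈ Icc 0 t, 0 ≤ᵐ[μ] fun ω => (J u ω).toReal * Z u ω := fun u hu => by
    filter_upwards [hS.1.nonneg (hT u hu)] with ω h using mul_nonneg ENNReal.toReal_nonneg h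
  have hVi : ∀ u ∈ Icc 0 t, Integrable (fun ω => (J u ω).toReal * Z u ω) μ := fun u hu => by
    refine (hS.2.1 u (hT u hu)).mono ((hVm u hu).mono (ℱ.le u)).aestronglyMeasurable
      (ae_of_all _ fun ω => ?_)
    rw [norm_mul, Real.norm_of_nonneg ENNReal.toReal_nonneg]
    exact mul_le_of_le_one_left (norm_nonneg _) (hr1 u ω)
  have hVof : ∀ u ω, ENNReal.ofReal ((J u ω).toReal * Z u ω) =
      J u ω * ENNReal.ofReal (Z u ω) := fun u ω => by
    rw [ENNReal.ofReal_mul ENNReal.toReal_nonneg,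
      ENNReal.ofReal_toReal ((hJ1 u ω).trans_lt ENNReal.one_lt_top).ne]
  have hchain := ae_exists_not_crossChain ht.1 hVm hVi hV0 (fun u hu v hv huv =>
    condExp_le_of_setLIntegral_le (ℱ.le u) (hVi v hv) (hVi u hu) (hVm u hu) (hV0 v hv) (hV0 u hu)
      fun A hA => by
        simp only [hVof]
        have := hJ Z hZ u v hu.1 huv hv.2 (A.indicator fun _ => 1)
          (Measurable.indicator measurable_const hA)
        rw [← lintegral_indicator (ℱ.le u A hA), ← lintegral_indicator (ℱ.le u A hA)]
        convert this using 3 with ω ω <;>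
        · by_cases h : ω ∈ A <;> simp [h]) (t + 1)
  filter_upwards [hchain, hS.ae_exists_gridSet_le ht (hpos t ht), hS.1.2.2]
    with ω hch ⟨ε, hε, hεle⟩ hcad
  constructor
  · intro u hu
    exact exists_tendsto_of_mul inf_le_right hε
      ((hcad.1 u ⟨hu.1, hu.2.trans_le ht.2⟩).mono_left inf_le_left) hεle
      (fun d => ENNReal.toReal_nonneg) (fun d => hr1 d ω)
      fun h h' => exists_tendsto_right_of_not_crossChain (by linarith [hu.2]) hch h h'
  · intro u hu
    obtain ⟨L, hL⟩ := hcad.2 u ⟨hu.1, hu.2.trans ht.2⟩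
    exact exists_tendsto_of_mul inf_le_right hε (hL.mono_left inf_le_left) hεle
      (fun d => ENNReal.toReal_nonneg) (fun d => hr1 d ω)
      fun h h' => exists_tendsto_left_of_not_crossChain (by linarith [hu.2]) hch h h'

end StableFamily

namespace StableFamily

variable {m0 : MeasurableSpace Ω} {μ : Measure Ω} [IsProbabilityMeasure μ] {T : ℝ}
  {ℱ : Filtration ℝ m0} {K : Set (ℝ → Ω → ℝ)}

/-- Càdlàg regularization of the family `J`. -/
lemma exists_regularization (hK : StableFamily μ T ℱ K)
    (hrc : ∀ t : ℝ, (ℱ t : MeasurableSpace Ω) = ⨅ (s : ℝ) (_ : t < s), ℱ s)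
    {t : ℝ} (ht : t ∈ Icc (0 : ℝ) T)
    {J : ℝ → Ω → ℝ≥0∞} (hJm : ∀ u ∈ Icc 0 t, Measurable[ℱ u] (J u)) (hJ1 : ∀ u ω, J u ω ≤ 1)
    (hJ : ∀ Z ∈ K, ∀ u v, 0 ≤ u → u ≤ v → v ≤ t → ∀ h : Ω → ℝ≥0∞, Measurable[ℱ u] h →
        ∫⁻ ω, h ω * (J v ω * ENNReal.ofReal (Z v ω)) ∂μ ≤
          ∫⁻ ω, h ω * (J u ω * ENNReal.ofReal (Z u ω)) ∂μ) :
    ∃ X : ℝ → Ω → ℝ, PosProc μ T ℱ X ∧ (∀ u ω, X u ω ≤ 1) ∧ (X t = fun ω => (J t ω).toReal) ∧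
      (∀ Z ∈ K, SuperMG μ T ℱ fun u ω => Z u ω * X u ω) ∧
      ∀ u, 0 ≤ u → u < t → ∫⁻ ω, ENNReal.ofReal (X u ω) ∂μ ≤ ∫⁻ ω, J u ω ∂μ := by
  set R : ℝ → Ω → ℝ≥0∞ := fun u ω =>
    if u < t then limsup (fun n => J (nextGrid t n u) ω) atTop else J t ω with hR
  have hRt : ∀ u, t ≤ u → R u = J t := fun u hu => by
    ext ω
    simp [hR, hu.not_gt]
  have hR1 : ∀ u ω, R u ω ≤ 1 := fun u ω => by
    by_cases h : u < t
    · simp only [hR, h, ↓reduceIte]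
      exact (limsup_le_limsup (Eventually.of_forall fun n => hJ1 _ ω)).trans (limsup_const _).le
    · simpa [hR, h] using hJ1 t ω
  have hRtop : ∀ u ω, R u ω ≠ ∞ := fun u ω => ((hR1 u ω).trans_lt ENNReal.one_lt_top).ne
  have hgrid : ∀ n u, nextGrid t n u ∈ Icc 0 t := fun n u => gridSet_subset ht.1 (nextGrid_mem t n u)
  have hT : ∀ u ∈ Icc 0 t, u ∈ Icc (0 : ℝ) T := fun u hu => ⟨hu.1, hu.2.trans ht.2⟩
  have hRm : ∀ u, 0 ≤ u → Measurable[ℱ u] (R u) := by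
    intro u hu
    by_cases h : u < t
    · refine measurable_of_rightCont (hrc u) fun v hv => ?_
      have hev : ∀ᶠ n in atTop, nextGrid t n u < v := (tendsto_nextGrid hu h).eventually_lt_const hv
      obtain ⟨N, hN⟩ := eventually_atTop.1 hev
      have : R u = fun ω => limsup (fun n => J (nextGrid t (n + N) u) ω) atTop := by
        ext ω
        simp only [hR, h, ↓reduceIte]
        exact (limsup_nat_add (fun n => J (nextGrid t n u) ω) N).symm
      rw [this]
      exact Measurable.limsup fun n => (hJm _ (hgrid _ u)).mono
        (ℱ.mono (hN (n + N) (Nat.le_add_left _ _)).le) le_rfl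
    · push Not at h
      rw [hRt u h]
      exact (hJm t ⟨ht.1, le_rfl⟩).mono (ℱ.mono h) le_rfl
  have hlim := hK.ae_exists_limits ht hJm hJ1 hJ
  have hreal : ∀ᵐ ω ∂μ, ∀ u ∈ Ico 0 t,
      Tendsto (fun n => (J (nextGrid t n u) ω).toReal) atTop (𝓝 (R u ω).toReal) := by
    filter_upwards [hlim] with ω hω u hu
    obtain ⟨c, hc⟩ := hω.1 u hu
    have h1 := hc.comp (tendsto_nextGrid_right hu.1 hu.2)
    have h2 : Tendsto (fun n => J (nextGrid t n u) ω) atTop (𝓝 (ENNReal.ofReal c)) := by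
      refine (ENNReal.tendsto_ofReal h1).congr fun n => ?_
      exact ENNReal.ofReal_toReal ((hJ1 _ ω).trans_lt ENNReal.one_lt_top).ne
    have h3 : R u ω = ENNReal.ofReal c := by
      simp only [hR, hu.2, ↓reduceIte]
      exact h2.limsup_eq
    rw [h3]
    exact (ENNReal.tendsto_toReal ENNReal.ofReal_ne_top).comp h2
  have henn : ∀ᵐ ω ∂μ, ∀ u ∈ Ico 0 t,
      Tendsto (fun n => J (nextGrid t n u) ω) atTop (𝓝 (R u ω)) := by
    filter_upwards [hreal] with ω hω u hu
    have := ENNReal.tendsto_ofReal (hω u hu)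
    rw [ENNReal.ofReal_toReal (hRtop u ω)] at this
    refine this.congr fun n => ENNReal.ofReal_toReal ((hJ1 _ ω).trans_lt ENNReal.one_lt_top).ne
  have hpos : PosProc μ T ℱ fun u ω => (R u ω).toReal := by
    refine ⟨fun u hu => (hRm u hu.1).ennreal_toReal.stronglyMeasurable,
      ae_of_all _ fun ω u _ => ENNReal.toReal_nonneg, ?_⟩
    filter_upwards [hlim, hreal] with ω hω hω'
    constructor
    · intro u hu
      rcases lt_or_ge u t with h | h
      · obtain ⟨c, hc⟩ := hω.1 u ⟨hu.1, h⟩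
        have hcR := tendsto_nhds_unique (hc.comp (tendsto_nextGrid_right hu.1 h)) (hω' u ⟨hu.1, h⟩)
        beta_reduce
        rw [← hcR]
        refine tendsto_of_eventually_tendsto_seq isOpen_Ioi hc (d := nextGrid t) ?_
        filter_upwards [Ioo_mem_nhdsGT h] with v hv
        have hv0 : 0 ≤ v := hu.1.trans hv.1.le
        exact ⟨tendsto_nextGrid hv0 hv.2, fun n => nextGrid_mem t n v, hω' v ⟨hv0, hv.2⟩⟩
      · refine tendsto_const_nhds.congr' ?_
        filter_upwards [self_mem_nhdsWithin] with v hv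
        rw [hRt u h, hRt v (h.trans (le_of_lt hv))]
    · intro u hu
      rcases le_or_gt u t with h | h
      · obtain ⟨c, hc⟩ := hω.2 u ⟨hu.1, h⟩
        refine ⟨c, tendsto_of_eventually_tendsto_seq isOpen_Iio hc (d := nextGrid t) ?_⟩
        filter_upwards [Ioo_mem_nhdsLT hu.1] with v hv
        have hvt : v < t := hv.2.trans_le h
        exact ⟨tendsto_nextGrid hv.1.le hvt, fun n => nextGrid_mem t n v, hω' v ⟨hv.1.le, hvt⟩⟩
      · refine ⟨(J t ω).toReal, tendsto_const_nhds.congr' ?_⟩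
        filter_upwards [Ioo_mem_nhdsLT h] with v hv
        rw [hRt v hv.1.le]
  have hprod : ∀ Z ∈ K, ∀ u, 0 ≤ u → u < t → ∀ᵐ ω ∂μ,
      Tendsto (fun n => ENNReal.ofReal (Z (nextGrid t n u) ω)) atTop
        (𝓝 (ENNReal.ofReal (Z u ω))) := by
    intro Z hZ u h0 hu
    filter_upwards [(hK.s1mem Z hZ).1.1.2.2] with ω hω
    exact ENNReal.tendsto_ofReal ((hω.1 u ⟨h0, hu.trans_le ht.2⟩).comp
      ((tendsto_nextGrid_right h0 hu).mono_right inf_le_left))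
  have hZm : ∀ Z ∈ K, ∀ u ∈ Icc 0 t, Measurable fun ω => ENNReal.ofReal (Z u ω) :=
    fun Z hZ u hu => (hK.s1mem Z hZ).1.1.measurable_ofReal' (hT u hu)
  have hJm0 : ∀ u ∈ Icc 0 t, Measurable (J u) := fun u hu => (hJm u hu).mono (ℱ.le u) le_rfl
  have hRm0 : ∀ u, 0 ≤ u → Measurable (R u) := fun u hu => (hRm u hu).mono (ℱ.le u) le_rfl
  have low : ∀ Z ∈ K, ∀ u, 0 ≤ u → u < t → ∀ h : Ω → ℝ≥0∞, Measurable h →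
      (∀ᵐ ω ∂μ, h ω ≠ ∞) → ∀ c,
      (∀ᶠ n in atTop, ∫⁻ ω, h ω * (J (nextGrid t n u) ω *
        ENNReal.ofReal (Z (nextGrid t n u) ω)) ∂μ ≤ c) →
      ∫⁻ ω, h ω * (R u ω * ENNReal.ofReal (Z u ω)) ∂μ ≤ c := by
    intro Z hZ u h0 hu h hh htop c hc
    refine lintegral_le_of_ae_tendsto (fun n => ?_) ?_ hc
    · exact (hh.mul ((hJm0 _ (hgrid n u)).mul (hZm Z hZ _ (hgrid n u)))).aemeasurable
    · filter_upwards [henn, hprod Z hZ u h0 hu, htop] with ω h1 h2 h3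
      exact ENNReal.Tendsto.const_mul
        (ENNReal.Tendsto.mul (h1 u ⟨h0, hu⟩) (Or.inr ENNReal.ofReal_ne_top) h2
        (Or.inr (hRtop u ω))) (Or.inr h3)
  have up : ∀ Z ∈ K, ∀ u, 0 ≤ u → u < t → ∀ h : Ω → ℝ≥0∞, Measurable[ℱ u] h →
      (∀ ω, h ω ≤ 1) → ∀ c,
      (∀ᶠ n in atTop, c ≤ ∫⁻ ω, h ω * (J (nextGrid t n u) ω *
        ENNReal.ofReal (Z (nextGrid t n u) ω)) ∂μ) →
      c ≤ ∫⁻ ω, h ω * (R u ω * ENNReal.ofReal (Z u ω)) ∂μ := by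
    intro Z hZ u h0 hu h hh h1 c hc
    have hS := (hK.s1mem Z hZ).1
    have hh0 := hh.mono (ℱ.le u) le_rfl
    have huT : u ∈ Icc (0 : ℝ) T := hT u ⟨h0, hu.le⟩
    have hfin : ∫⁻ ω, h ω * ENNReal.ofReal (Z u ω) ∂μ ≠ ∞ :=
      ((lintegral_mono fun ω => mul_le_of_le_one_left zero_le (h1 ω)).trans_lt
        (hS.lintegral_lt_top huT)).ne
    have hcfin : c ≠ ∞ := by
      obtain ⟨n, hn⟩ := hc.exists
      refine ((hn.trans (lintegral_mono fun ω => ?_)).trans_lt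
        (hS.lintegral_lt_top (hT _ (hgrid n u)))).ne
      calc h ω * (J (nextGrid t n u) ω * ENNReal.ofReal (Z (nextGrid t n u) ω))
          ≤ 1 * (1 * ENNReal.ofReal (Z (nextGrid t n u) ω)) := by
            gcongr
            · exact h1 ω
            · exact hJ1 _ ω
        _ = _ := by simp
    have split : ∀ j z x : ℝ≥0∞, j ≤ 1 → x * (j * z) + x * ((1 - j) * z) = x * z := by
      intro j z x hj
      rw [← mul_add, ← add_mul, add_tsub_cancel_of_le hj, one_mul]
    have key : ∫⁻ ω, h ω * ((1 - R u ω) * ENNReal.ofReal (Z u ω)) ∂μ ≤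
        ∫⁻ ω, h ω * ENNReal.ofReal (Z u ω) ∂μ - c := by
      refine lintegral_le_of_ae_tendsto (f := fun n ω => h ω * ((1 - J (nextGrid t n u) ω) *
        ENNReal.ofReal (Z (nextGrid t n u) ω))) (fun n => ?_) ?_ ?_
      · exact (hh0.mul ((measurable_const.sub (hJm0 _ (hgrid n u))).mul
          (hZm Z hZ _ (hgrid n u)))).aemeasurable
      · filter_upwards [henn, hprod Z hZ u h0 hu] with ω a1 a2
        refine ENNReal.Tendsto.const_mul (ENNReal.Tendsto.mul (ENNReal.Tendsto.sub
          tendsto_const_nhds (a1 u ⟨h0, hu⟩) (Or.inl ENNReal.one_ne_top))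
          (Or.inr ENNReal.ofReal_ne_top) a2 (Or.inr ?_))
          (Or.inr ((h1 ω).trans_lt ENNReal.one_lt_top).ne)
        exact (tsub_le_self.trans_lt ENNReal.one_lt_top).ne
      · filter_upwards [hc] with n hn
        refine ENNReal.le_sub_of_add_le_left hcfin ((add_le_add_left hn _).trans ?_)
        rw [← lintegral_add_left (f := fun ω => h ω * (J (nextGrid t n u) ω *
          ENNReal.ofReal (Z (nextGrid t n u) ω)))
          (hh0.mul ((hJm0 _ (hgrid n u)).mul (hZm Z hZ _ (hgrid n u))))]
        rw [lintegral_congr fun ω => split _ _ _ (hJ1 _ ω)]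
        exact hS.lintegral_mul_le huT (hT _ (hgrid n u)) (lt_nextGrid n hu).le hh
    have hsum : ∫⁻ ω, h ω * (R u ω * ENNReal.ofReal (Z u ω)) ∂μ +
        ∫⁻ ω, h ω * ((1 - R u ω) * ENNReal.ofReal (Z u ω)) ∂μ =
        ∫⁻ ω, h ω * ENNReal.ofReal (Z u ω) ∂μ := by
      rw [← lintegral_add_left
        (f := fun ω => h ω * (R u ω * ENNReal.ofReal (Z u ω)))
        (hh0.mul ((hRm0 u h0).mul (hZm Z hZ _ ⟨h0, hu.le⟩)))]
      exact lintegral_congr fun ω => split _ _ _ (hR1 u ω)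
    have hcle : c ≤ ∫⁻ ω, h ω * ENNReal.ofReal (Z u ω) ∂μ := by
      obtain ⟨n, hn⟩ := hc.exists
      refine (hn.trans (lintegral_mono fun ω => ?_)).trans
        (hS.lintegral_mul_le huT (hT _ (hgrid n u)) (lt_nextGrid n hu).le hh)
      gcongr
      exact mul_le_of_le_one_left zero_le (hJ1 _ ω)
    have hB : ∫⁻ ω, h ω * ((1 - R u ω) * ENNReal.ofReal (Z u ω)) ∂μ ≠ ∞ :=
      (key.trans_lt (tsub_le_self.trans_lt hfin.lt_top)).ne
    refine (ENNReal.add_le_add_iff_right hB).1 ?_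
    rw [hsum]
    exact (add_le_add_right key c).trans (add_tsub_cancel_of_le hcle).le
  refine ⟨fun u ω => (R u ω).toReal, hpos, fun u ω => ?_, by simp [hRt], fun Z hZ => ?_,
    fun u h0 hu => ?_⟩
  · simpa using ENNReal.toReal_mono ENNReal.one_ne_top (hR1 u ω)
  · have hS := (hK.s1mem Z hZ).1
    have hof : ∀ u ω, ENNReal.ofReal (Z u ω * (R u ω).toReal) =
        R u ω * ENNReal.ofReal (Z u ω) := fun u ω => by
      rw [mul_comm, ENNReal.ofReal_mul ENNReal.toReal_nonneg, ENNReal.ofReal_toReal (hRtop u ω)]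
    refine SuperMG.of_setLIntegral_le (hS.1.mul hpos) (fun u hu => ?_)
      fun u v hu hv huv A hA => ?_
    · simp only [hof]
      exact (lintegral_mono fun ω => mul_le_of_le_one_left zero_le (hR1 u ω)).trans_lt
        (hS.lintegral_lt_top hu)
    · simp only [hof]
      set h : Ω → ℝ≥0∞ := A.indicator fun _ => 1 with hh
      have hhm : Measurable[ℱ u] h := Measurable.indicator measurable_const hA
      have hh1 : ∀ ω, h ω ≤ 1 := fun ω => indicator_le_self' (fun _ _ => zero_le) ω
      have e : ∀ f : Ω → ℝ≥0∞, ∫⁻ ω in A, f ω ∂μ = ∫⁻ ω, h ω * f ω ∂μ := fun f => by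
        rw [← lintegral_indicator (ℱ.le u A hA)]
        exact lintegral_congr fun ω => by by_cases hω : ω ∈ A <;> simp [hh, hω]
      rw [e, e]
      rcases huv.eq_or_lt with rfl | huv'
      · exact le_rfl
      have tail : ∀ u, t ≤ u → u ∈ Icc (0 : ℝ) T → ∀ h : Ω → ℝ≥0∞, ∀ w, t ≤ w → w ≤ u →
          w ∈ Icc (0 : ℝ) T → Measurable[ℱ w] h →
          ∫⁻ ω, h ω * (J t ω * ENNReal.ofReal (Z u ω)) ∂μ ≤
            ∫⁻ ω, h ω * (J t ω * ENNReal.ofReal (Z w ω)) ∂μ := by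
        intro u htu hu h w htw hwu hw hm
        have := hS.lintegral_mul_le hw hu hwu (h := fun ω => h ω * J t ω)
          (hm.mul ((hJm t ⟨ht.1, le_rfl⟩).mono (ℱ.mono htw) le_rfl))
        simpa only [mul_assoc] using this
      rcases le_or_gt t u with htu | htu
      · rw [hRt u htu, hRt v (htu.trans huv)]
        exact tail v (htu.trans huv) hv h u htu huv hu hhm
      · refine up Z hZ u hu.1 htu h hhm hh1 _ ?_
        rcases le_or_gt t v with htv | htv
        · filter_upwards with n
          rw [hRt v htv]
          refine (tail v htv hv h t le_rfl htv ht (hhm.mono (ℱ.mono htu.le) le_rfl)).trans ?_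
          exact hJ Z hZ _ _ (hgrid n u).1 (hgrid n u).2 le_rfl h
            (hhm.mono (ℱ.mono (lt_nextGrid n htu).le) le_rfl)
        · filter_upwards [(tendsto_nextGrid hu.1 htu).eventually_lt_const huv'] with n hn
          refine low Z hZ v hv.1 htv h (hhm.mono (ℱ.le u) le_rfl)
            (ae_of_all _ fun ω => ((hh1 ω).trans_lt ENNReal.one_lt_top).ne) _ ?_
          filter_upwards with m
          exact hJ Z hZ _ _ (hgrid n u).1 (hn.trans (lt_nextGrid m htv)).le (hgrid m v).2 h
            (hhm.mono (ℱ.mono (lt_nextGrid n htu).le) le_rfl)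
  · obtain ⟨Z, hZ, hZpos⟩ := hK.exists_pos
    have hS := (hK.s1mem Z hZ).1
    have huT : u ∈ Icc (0 : ℝ) T := hT u ⟨h0, hu.le⟩
    have hinv : ∀ f : Ω → ℝ≥0∞, ∫⁻ ω, (ENNReal.ofReal (Z u ω))⁻¹ *
        (f ω * ENNReal.ofReal (Z u ω)) ∂μ = ∫⁻ ω, f ω ∂μ := fun f => by
      refine lintegral_congr_ae ?_
      filter_upwards [hZpos u huT] with ω p
      rw [mul_comm, mul_assoc, ENNReal.mul_inv_cancel, mul_one]
      · simpa using p
      · exact ENNReal.ofReal_ne_top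
    have hcong : ∫⁻ ω, ENNReal.ofReal (R u ω).toReal ∂μ = ∫⁻ ω, R u ω ∂μ :=
      lintegral_congr fun ω => ENNReal.ofReal_toReal (hRtop u ω)
    rw [hcong, ← hinv, ← hinv (J u)]
    have hmi : Measurable[ℱ u] fun ω => (ENNReal.ofReal (Z u ω))⁻¹ :=
      (hS.1.measurable_ofReal huT).inv
    refine low Z hZ u h0 hu _ (hmi.mono (ℱ.le u) le_rfl) ?_ _ ?_
    · filter_upwards [hZpos u huT] with ω p
      simpa using p
    · filter_upwards with n
      exact hJ Z hZ _ _ h0 (lt_nextGrid n hu).le (hgrid n u).2 _ hmi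

end StableFamily

namespace StableFamily

variable {m0 : MeasurableSpace Ω} {μ : Measure Ω} [IsProbabilityMeasure μ] {T : ℝ}
  {ℱ : Filtration ℝ m0} {K C : Set (ℝ → Ω → ℝ)} {Y : ℝ → Ω → ℝ}

/-- Elements of the bipolar of a subset of `K` do not exceed, in any bounded direction,
the one-period returns available in `K`. -/
lemma lintegral_mul_div_le (hK : StableFamily μ T ℱ K)
    (hrc : ∀ t : ℝ, (ℱ t : MeasurableSpace Ω) = ⨅ (s : ℝ) (_ : t < s), ℱ s)
    (hCK : C ⊆ K) (hY : Y ∈ procPolar μ T ℱ (procPolar μ T ℱ C))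
    {s t : ℝ} (hs : 0 ≤ s) (hst : s < t) (ht : t ≤ T)
    {g : Ω → ℝ≥0∞} (hg : Measurable[ℱ t] g) (hg1 : ∀ ω, g ω ≤ 1) {x : ℝ≥0∞}
    (hx : ∀ ρ ∈ ratioSet μ ℱ K s t, ∫⁻ ω, g ω * ρ ω ∂μ ≤ x) :
    ∫⁻ ω, g ω * (ENNReal.ofReal (Y t ω) / ENNReal.ofReal (Y s ω)) ∂μ ≤ x := by
  have htT : t ∈ Icc (0 : ℝ) T := ⟨hs.trans hst.le, ht⟩
  have hsT : s ∈ Icc (0 : ℝ) T := ⟨hs, hst.le.trans ht⟩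
  obtain ⟨J, hJm, hJ1, hJt, hJ, hJx⟩ := hK.exists_condSup_family htT hg hg1
  obtain ⟨X, hX, hX1, hXt, hXS, hXJ⟩ := hK.exists_regularization hrc htT hJm hJ1 hJ
  have hXC : X ∈ procPolar μ T ℱ C := by
    refine ⟨hX, fun Z hZ => ⟨hXS Z (hCK hZ), ?_⟩⟩
    have h0 : (0 : ℝ) ∈ Icc 0 T := ⟨le_rfl, htT.1.trans htT.2⟩
    filter_upwards [(hK.s1mem Z (hCK hZ)).2, hX.nonneg h0] with ω h1 h2
    exact mul_le_one₀ h1 h2 (hX1 0 ω)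
  have hXY := (hY.2 X hXC).1
  have hYm := hY.1.measurable_ofReal hsT
  have key := hXY.lintegral_mul_le hsT htT hst.le (h := fun ω => (ENNReal.ofReal (Y s ω))⁻¹)
    hYm.inv
  calc ∫⁻ ω, g ω * (ENNReal.ofReal (Y t ω) / ENNReal.ofReal (Y s ω)) ∂μ
      = ∫⁻ ω, (ENNReal.ofReal (Y s ω))⁻¹ * ENNReal.ofReal (X t ω * Y t ω) ∂μ := by
        refine lintegral_congr fun ω => ?_
        rw [hXt, hJt, ENNReal.ofReal_mul ENNReal.toReal_nonneg, ENNReal.ofReal_toReal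
          ((hg1 ω).trans_lt ENNReal.one_lt_top).ne, div_eq_mul_inv]
        ring
    _ ≤ ∫⁻ ω, (ENNReal.ofReal (Y s ω))⁻¹ * ENNReal.ofReal (X s ω * Y s ω) ∂μ := key
    _ ≤ ∫⁻ ω, ENNReal.ofReal (X s ω) ∂μ := by
        refine lintegral_mono_ae ?_
        filter_upwards [hX.nonneg hsT] with ω h1
        rw [ENNReal.ofReal_mul h1, mul_left_comm]
        exact mul_le_of_le_one_right zero_le (ENNReal.inv_mul_le_one _)
    _ ≤ x := (hXJ s hs hst).trans (hJx s hs hst x hx)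

/-- Elements of the bipolar of a subset of `K` are supermartingales. -/
lemma superMG_of_mem_bipolar (hK : StableFamily μ T ℱ K) (hCK : C ⊆ K)
    (hY : Y ∈ procPolar μ T ℱ (procPolar μ T ℱ C)) : SuperMG μ T ℱ Y := by
  have h1 : (fun _ _ => 1 : ℝ → Ω → ℝ) ∈ procPolar μ T ℱ C := by
    refine ⟨⟨fun t _ => stronglyMeasurable_const, ae_of_all _ fun ω t _ => zero_le_one,
      ae_of_all _ fun ω => ⟨fun t _ => tendsto_const_nhds, fun t _ => ⟨1, tendsto_const_nhds⟩⟩⟩,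
      fun Z hZ => ?_⟩
    simp only [mul_one]
    exact hK.s1mem Z (hCK hZ)
  simpa using (hY.2 _ h1).1

end StableFamily

section Projection

variable {m : MeasurableSpace Ω} {μ : Measure Ω}

lemma iSup_min_natCast (a : ℝ≥0∞) : ⨆ n : ℕ, min a (n : ℝ≥0∞) = a := by
  rw [← inf_iSup_eq, ENNReal.iSup_natCast, inf_top_eq]

/-- Truncation and monotone convergence inside an integral. -/
lemma lintegral_mul_le_of_forall_min {G f : Ω → ℝ≥0∞} (hG : Measurable G) (hf : Measurable f)
    {c : ℝ≥0∞} (h : ∀ n : ℕ, ∫⁻ ω, min (G ω) n * f ω ∂μ ≤ c) : ∫⁻ ω, G ω * f ω ∂μ ≤ c := by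
  have e : ∀ ω, G ω * f ω = ⨆ n : ℕ, min (G ω) n * f ω := fun ω => by
    rw [← ENNReal.iSup_mul, iSup_min_natCast]
  rw [lintegral_congr e, lintegral_iSup (f := fun (n : ℕ) ω => min (G ω) n * f ω)]
  · exact iSup_le h
  · exact fun n => (hG.min measurable_const).mul hf
  · intro i j hij ω
    dsimp only
    gcongr

/-- If `f` is dominated by `R` in all directions bounded by one, then in all directions. -/
lemma lintegral_mul_le_of_bounded {R : Set (Ω → ℝ≥0∞)} {f : Ω → ℝ≥0∞} (hf : Measurable f)
    (hpol : ∀ g : Ω → ℝ≥0∞, Measurable g → (∀ ω, g ω ≤ 1) → ∀ x,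
      (∀ ρ ∈ R, ∫⁻ ω, g ω * ρ ω ∂μ ≤ x) → ∫⁻ ω, g ω * f ω ∂μ ≤ x)
    {G : Ω → ℝ≥0∞} (hG : Measurable G) {x : ℝ≥0∞} (hx : ∀ ρ ∈ R, ∫⁻ ω, G ω * ρ ω ∂μ ≤ x)
    (hR : ∀ ρ ∈ R, Measurable ρ) :
    ∫⁻ ω, G ω * f ω ∂μ ≤ x := by
  refine lintegral_mul_le_of_forall_min hG hf fun n => ?_
  rcases n.eq_zero_or_pos with rfl | hn
  · simp
  have hn0 : (n : ℝ≥0∞) ≠ 0 := by exact_mod_cast hn.ne'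
  have hnt : (n : ℝ≥0∞) ≠ ∞ := ENNReal.natCast_ne_top n
  have hm : Measurable fun ω => min (G ω) n := hG.min measurable_const
  have key := hpol (fun ω => (n : ℝ≥0∞)⁻¹ * min (G ω) n) (measurable_const.mul hm) (fun ω => ?_)
    ((n : ℝ≥0∞)⁻¹ * x) fun ρ hρ => ?_
  · simp only [mul_assoc] at key
    rw [lintegral_const_mul (f := fun ω => min (G ω) n * f ω) _ (hm.mul hf)] at key
    have := mul_le_mul_right key (n : ℝ≥0∞)
    rwa [← mul_assoc, ← mul_assoc, ENNReal.mul_inv_cancel hn0 hnt, one_mul, one_mul] at this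
  · calc (n : ℝ≥0∞)⁻¹ * min (G ω) n ≤ (n : ℝ≥0∞)⁻¹ * n := by gcongr; exact min_le_right _ _
      _ = 1 := ENNReal.inv_mul_cancel hn0 hnt
  · simp only [mul_assoc]
    rw [lintegral_const_mul (f := fun ω => min (G ω) n * ρ ω) _ (hm.mul (hR ρ hρ))]
    gcongr
    refine (lintegral_mono fun ω => ?_).trans (hx ρ hρ)
    gcongr
    exact min_le_left _ _

variable [IsProbabilityMeasure μ]

/-- The square-integrable classes represented by finite elements of `R`. -/
def l2Classes (μ : Measure Ω) (R : Set (Ω → ℝ≥0∞)) : Set (Lp ℝ 2 μ) :=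
  {W | ∃ ρ ∈ R, (∀ ω, ρ ω ≠ ∞) ∧ W =ᵐ[μ] fun ω => (ρ ω).toReal}

lemma mem_closure_l2Classes {R : Set (Ω → ℝ≥0∞)} (hRne : R.Nonempty)
    (hRm : ∀ ρ ∈ R, Measurable ρ)
    (hRc : ∀ ρ₁ ∈ R, ∀ ρ₂ ∈ R, ∀ a b : ℝ, 0 ≤ a → 0 ≤ b → a + b = 1 →
      (fun ω => ENNReal.ofReal a * ρ₁ ω + ENNReal.ofReal b * ρ₂ ω) ∈ R)
    (hRs : ∀ ρ ∈ R, ∀ ρ' : Ω → ℝ≥0∞, Measurable ρ' → (∀ ω, ρ' ω ≤ ρ ω) → ρ' ∈ R)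
    {f : Ω → ℝ≥0∞} (hf : Measurable f)
    (hpol : ∀ g : Ω → ℝ≥0∞, Measurable g → (∀ ω, g ω ≤ 1) → ∀ x,
      (∀ ρ ∈ R, ∫⁻ ω, g ω * ρ ω ∂μ ≤ x) → ∫⁻ ω, g ω * f ω ∂μ ≤ x)
    {F : Lp ℝ 2 μ} (hF0 : ∀ᵐ ω ∂μ, 0 ≤ F ω) (hFf : ∀ᵐ ω ∂μ, ENNReal.ofReal (F ω) ≤ f ω) :
    F ∈ closure (l2Classes μ R) := by
  obtain ⟨ρ₀, hρ₀⟩ := hRne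
  have hzero : (0 : Lp ℝ 2 μ) ∈ l2Classes μ R :=
    ⟨fun _ => 0, hRs ρ₀ hρ₀ _ measurable_const fun _ => zero_le, fun _ => ENNReal.zero_ne_top,
      Eventually.of_forall fun ω => by simp⟩
  have hconv : Convex ℝ (l2Classes μ R) := by
    rintro U ⟨ρ, hρ, hρt, hU⟩ V ⟨η, hη, hηt, hV⟩ a b ha hb hab
    refine ⟨_, hRc ρ hρ η hη a b ha hb hab, fun ω => ?_, ?_⟩
    · exact ENNReal.add_ne_top.2 ⟨ENNReal.mul_ne_top ENNReal.ofReal_ne_top (hρt ω),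
        ENNReal.mul_ne_top ENNReal.ofReal_ne_top (hηt ω)⟩
    · filter_upwards [hU, hV, Lp.coeFn_add (a • U) (b • V), Lp.coeFn_smul a U,
        Lp.coeFn_smul b V] with ω h1 h2 h3 h4 h5
      rw [h3, Pi.add_apply, h4, h5, Pi.smul_apply, Pi.smul_apply, h1, h2, ENNReal.toReal_add
        (ENNReal.mul_ne_top ENNReal.ofReal_ne_top (hρt ω))
        (ENNReal.mul_ne_top ENNReal.ofReal_ne_top (hηt ω)), ENNReal.toReal_mul,
        ENNReal.toReal_mul, ENNReal.toReal_ofReal ha, ENNReal.toReal_ofReal hb]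
      simp
  obtain ⟨P, hP, hPmin⟩ := exists_norm_eq_iInf_of_complete_convex
    (K := closure (l2Classes μ R)) ⟨0, subset_closure hzero⟩ isClosed_closure.isComplete
    hconv.closure F
  rw [norm_eq_iInf_iff_real_inner_le_zero hconv.closure hP] at hPmin
  set φ : Lp ℝ 2 μ := F - P with hφ
  set c : ℝ := inner ℝ φ P with hc
  have hle : ∀ W ∈ l2Classes μ R, inner ℝ φ W ≤ c := fun W hW => by
    have := hPmin W (subset_closure hW)
    rw [inner_sub_right] at this
    linarith
  have hφm : Measurable fun ω => φ ω := (Lp.stronglyMeasurable φ).measurable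
  have hGm : Measurable fun ω => ENNReal.ofReal (φ ω) := hφm.ennreal_ofReal
  -- the directions of `R` are bounded by `c` against the positive part of `φ`
  have hR : ∀ ρ ∈ R, ∫⁻ ω, ENNReal.ofReal (φ ω) * ρ ω ∂μ ≤ ENNReal.ofReal c := by
    intro ρ hρ
    simp only [mul_comm (ENNReal.ofReal _)]
    refine lintegral_mul_le_of_forall_min (hRm ρ hρ) hGm fun n => ?_
    set w : Ω → ℝ≥0∞ := {ω | 0 < φ ω}.indicator fun ω => min (ρ ω) n with hw
    have hwm : Measurable w :=
      ((hRm ρ hρ).min measurable_const).indicator (measurableSet_lt measurable_const hφm)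
    have hwn : ∀ ω, w ω ≤ n := fun ω =>
      (indicator_le_self' (fun _ _ => zero_le) ω).trans (min_le_right _ _)
    have hwt : ∀ ω, w ω ≠ ∞ := fun ω => ((hwn ω).trans_lt (ENNReal.natCast_lt_top n)).ne
    have hwL : MemLp (fun ω => (w ω).toReal) 2 μ := by
      refine MemLp.of_bound hwm.ennreal_toReal.aestronglyMeasurable n (ae_of_all _ fun ω => ?_)
      rw [Real.norm_of_nonneg ENNReal.toReal_nonneg]
      simpa using ENNReal.toReal_mono (ENNReal.natCast_ne_top n) (hwn ω)
    have hwR : w ∈ R := hRs ρ hρ w hwm fun ω =>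
      (indicator_le_self' (fun _ _ => zero_le) ω).trans (min_le_left _ _)
    set W : Lp ℝ 2 μ := hwL.toLp
    have hin := hle W ⟨w, hwR, hwt, hwL.coeFn_toLp⟩
    have hinte := L2.integrable_inner (𝕜 := ℝ) φ W
    have hval : ∀ᵐ ω ∂μ, ENNReal.ofReal (inner ℝ (φ ω) (W ω)) =
        min (ρ ω) n * ENNReal.ofReal (φ ω) ∧ 0 ≤ inner ℝ (φ ω) (W ω) := by
      filter_upwards [hwL.coeFn_toLp] with ω h
      rw [h]
      by_cases hp : 0 < φ ω
      · have : inner ℝ (φ ω) (w ω).toReal = (w ω).toReal * φ ω := rfl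
        rw [this, ENNReal.ofReal_mul ENNReal.toReal_nonneg, ENNReal.ofReal_toReal (hwt ω)]
        refine ⟨?_, mul_nonneg ENNReal.toReal_nonneg hp.le⟩
        simp [hw, hp]
      · have h0 : w ω = 0 := by simp [hw, hp]
        simp [h0, ENNReal.ofReal_of_nonpos (not_lt.1 hp)]
    rw [L2.inner_def] at hin
    calc ∫⁻ ω, min (ρ ω) n * ENNReal.ofReal (φ ω) ∂μ
        = ∫⁻ ω, ENNReal.ofReal (inner ℝ (φ ω) (W ω)) ∂μ :=
          lintegral_congr_ae (hval.mono fun ω h => h.1.symm)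
      _ = ENNReal.ofReal (∫ ω, inner ℝ (φ ω) (W ω) ∂μ) :=
          (ofReal_integral_eq_lintegral_ofReal hinte (hval.mono fun ω h => h.2)).symm
      _ ≤ ENNReal.ofReal c := ENNReal.ofReal_le_ofReal hin
  have hfc := lintegral_mul_le_of_bounded hf hpol hGm hR hRm
  have hc0 : 0 ≤ c := by simpa using hle 0 hzero
  have hFc : inner ℝ φ F ≤ c := by
    have hinte := L2.integrable_inner (𝕜 := ℝ) φ F
    rw [L2.inner_def]
    have hle' : ∀ᵐ ω ∂μ, ENNReal.ofReal (inner ℝ (φ ω) (F ω)) ≤ ENNReal.ofReal (φ ω) * f ω := by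
      filter_upwards [hF0, hFf] with ω h1 h2
      have : inner ℝ (φ ω) (F ω) = F ω * φ ω := rfl
      rw [this, ENNReal.ofReal_mul h1, mul_comm]
      gcongr
    have h1 : ∫⁻ ω, ENNReal.ofReal (inner ℝ (φ ω) (F ω)) ∂μ ≤ ENNReal.ofReal c :=
      (lintegral_mono_ae hle').trans hfc
    rw [integral_eq_lintegral_pos_part_sub_lintegral_neg_part hinte]
    have h2 := ENNReal.toReal_mono ENNReal.ofReal_ne_top h1
    rw [ENNReal.toReal_ofReal hc0] at h2
    linarith [ENNReal.toReal_nonneg (a := ∫⁻ ω, ENNReal.ofReal (-inner ℝ (φ ω) (F ω)) ∂μ)]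
  have hn : inner ℝ φ φ ≤ 0 := by
    nth_rw 2 [hφ]
    rw [inner_sub_right]
    linarith
  have : φ = 0 := real_inner_self_nonpos.1 hn
  have hFP : F = P := sub_eq_zero.1 this
  exact hFP ▸ hP

/-- A convex solid set of nonnegative functions contains in its a.e. sequential closure every
finite function dominated by it in all directions. -/
lemma exists_seq_tendsto_of_convex_solid {R : Set (Ω → ℝ≥0∞)} (hRne : R.Nonempty)
    (hRm : ∀ ρ ∈ R, Measurable ρ)
    (hRc : ∀ ρ₁ ∈ R, ∀ ρ₂ ∈ R, ∀ a b : ℝ, 0 ≤ a → 0 ≤ b → a + b = 1 →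
      (fun ω => ENNReal.ofReal a * ρ₁ ω + ENNReal.ofReal b * ρ₂ ω) ∈ R)
    (hRs : ∀ ρ ∈ R, ∀ ρ' : Ω → ℝ≥0∞, Measurable ρ' → (∀ ω, ρ' ω ≤ ρ ω) → ρ' ∈ R)
    {f : Ω → ℝ≥0∞} (hf : Measurable f) (hft : ∀ᵐ ω ∂μ, f ω ≠ ∞)
    (hpol : ∀ g : Ω → ℝ≥0∞, Measurable g → (∀ ω, g ω ≤ 1) → ∀ x,
      (∀ ρ ∈ R, ∫⁻ ω, g ω * ρ ω ∂μ ≤ x) → ∫⁻ ω, g ω * f ω ∂μ ≤ x) :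
    ∃ ρ : ℕ → Ω → ℝ≥0∞, (∀ n, ρ n ∈ R) ∧
      ∀ᵐ ω ∂μ, Tendsto (fun n => ρ n ω) atTop (𝓝 (f ω)) := by
  have hle : ∀ (n : ℕ) ω, min (f ω) n ≤ n := fun n ω => min_le_right _ _
  have hFL : ∀ n : ℕ, MemLp (fun ω => (min (f ω) n).toReal) 2 μ := fun n => by
    refine MemLp.of_bound (hf.min measurable_const).ennreal_toReal.aestronglyMeasurable n
      (ae_of_all _ fun ω => ?_)
    rw [Real.norm_of_nonneg ENNReal.toReal_nonneg]
    simpa using ENNReal.toReal_mono (ENNReal.natCast_ne_top n) (hle n ω)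
  have hcl : ∀ n : ℕ, (hFL n).toLp ∈ closure (l2Classes μ R) := fun n => by
    refine mem_closure_l2Classes hRne hRm hRc hRs hf hpol ?_ ?_
    · filter_upwards [(hFL n).coeFn_toLp] with ω h
      rw [h]
      exact ENNReal.toReal_nonneg
    · filter_upwards [(hFL n).coeFn_toLp] with ω h
      rw [h, ENNReal.ofReal_toReal ((hle n ω).trans_lt (ENNReal.natCast_lt_top n)).ne]
      exact min_le_left _ _
  have hex : ∀ n : ℕ, ∃ W ∈ l2Classes μ R, dist ((hFL n).toLp) W < 1 / ((n : ℝ) + 1) := fun n =>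
    Metric.mem_closure_iff.1 (hcl n) _ Nat.one_div_pos_of_nat
  choose W hW hWd using hex
  choose ρ hρ hρt hWρ using hW
  have hd : Tendsto (fun n => (hFL n).toLp - W n) atTop (𝓝 0) := by
    rw [tendsto_zero_iff_norm_tendsto_zero]
    refine squeeze_zero (fun n => norm_nonneg _) (fun n => ?_)
      tendsto_one_div_add_atTop_nhds_zero_nat
    rw [← dist_eq_norm]
    exact (hWd n).le
  obtain ⟨ns, hns, hlim⟩ := (tendstoInMeasure_of_tendsto_Lp hd).exists_seq_tendsto_ae
  refine ⟨fun k => ρ (ns k), fun k => hρ _, ?_⟩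
  have hall := ae_all_iff.2 fun n => (hFL n).coeFn_toLp
  have hall' := ae_all_iff.2 fun n => hWρ n
  have hsub := ae_all_iff.2 fun n => Lp.coeFn_sub (hFL n).toLp (W n)
  filter_upwards [hlim, hall, hall', hsub, hft, Lp.coeFn_zero ℝ 2 μ] with ω h1 h2 h3 h4 h5 h6
  rw [h6] at h1
  simp only [h4, Pi.sub_apply, h2, h3, Pi.zero_apply] at h1
  have hmin : Tendsto (fun k => (min (f ω) (ns k)).toReal) atTop (𝓝 (f ω).toReal) := by
    refine tendsto_const_nhds.congr' ?_
    obtain ⟨N, hN⟩ := ENNReal.exists_nat_gt h5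
    filter_upwards [hns.tendsto_atTop.eventually_ge_atTop N] with k hk
    rw [min_eq_left (hN.le.trans (by exact_mod_cast hk))]
  have := ENNReal.tendsto_ofReal (hmin.sub h1)
  simp only [sub_sub_cancel, sub_zero] at this
  rw [ENNReal.ofReal_toReal h5] at this
  exact this.congr fun k => ENNReal.ofReal_toReal (hρt _ ω)

end Projection

section

variable {m0 : MeasurableSpace Ω} {μ : Measure Ω} [IsProbabilityMeasure μ] {T : ℝ}
  {ℱ : Filtration ℝ m0} {K C : Set (ℝ → Ω → ℝ)} {Y : ℝ → Ω → ℝ}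

lemma ae_trim_ne_top_iff {m : MeasurableSpace Ω} (hm : m ≤ m0) {f : Ω → ℝ≥0∞} (hf : Measurable[m] f) :
    (∀ᵐ ω ∂μ.trim hm, f ω ≠ ∞) ↔ ∀ᵐ ω ∂μ, f ω ≠ ∞ := by
  have h := trim_measurableSet_eq (μ := μ) hm (hf (measurableSet_singleton ∞))
  rw [ae_iff, ae_iff]
  simp only [not_not]
  exact iff_of_eq (congrArg (· = 0) h)

namespace StableFamily

/-- One-period returns of elements of the bipolar are a.s. limits of returns in `K`. -/
lemma exists_seq_ratio_tendsto (hK : StableFamily μ T ℱ K)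
    (hrc : ∀ t : ℝ, (ℱ t : MeasurableSpace Ω) = ⨅ (s : ℝ) (_ : t < s), ℱ s)
    (hCK : C ⊆ K) (hY : Y ∈ procPolar μ T ℱ (procPolar μ T ℱ C))
    {s t : ℝ} (hs : 0 ≤ s) (hst : s < t) (ht : t ≤ T) :
    ∃ ρ : ℕ → Ω → ℝ≥0∞, (∀ n, ρ n ∈ ratioSet μ ℱ K s t) ∧ ∀ᵐ ω ∂μ,
      Tendsto (fun n => ρ n ω) atTop (𝓝 (ENNReal.ofReal (Y t ω) / ENNReal.ofReal (Y s ω))) := by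
  have htT : t ∈ Icc (0 : ℝ) T := ⟨hs.trans hst.le, ht⟩
  have hsT : s ∈ Icc (0 : ℝ) T := ⟨hs, hst.le.trans ht⟩
  have hYS := hK.superMG_of_mem_bipolar hCK hY
  set f : Ω → ℝ≥0∞ := fun ω => ENNReal.ofReal (Y t ω) / ENNReal.ofReal (Y s ω) with hf
  have hfm : Measurable[ℱ t] f := (hYS.1.measurable_ofReal htT).div
    ((hYS.1.measurable_ofReal hsT).mono (ℱ.mono hst.le) le_rfl)
  have hft : ∀ᵐ ω ∂μ, f ω ≠ ∞ := by
    filter_upwards [hYS.ae_eq_zero_of_eq_zero hsT htT hst.le, hYS.1.nonneg hsT] with ω h1 h2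
    rcases h2.eq_or_lt with h | h
    · simp [hf, h1 h.symm]
    · exact ENNReal.div_ne_top ENNReal.ofReal_ne_top (by simpa using h)
  have hprob : @IsProbabilityMeasure Ω (ℱ t) (μ.trim (ℱ.le t)) :=
    @IsProbabilityMeasure.mk Ω (ℱ t) _ (by
      rw [trim_measurableSet_eq (ℱ.le t) MeasurableSet.univ, measure_univ])
  have hRm : ∀ ρ ∈ ratioSet μ ℱ K s t, Measurable[ℱ t] ρ := fun ρ hρ => hρ.1
  have hne : (ratioSet μ ℱ K s t).Nonempty := by
    obtain ⟨Z, hZ, -⟩ := hK.far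
    obtain ⟨ρ, hρ, -⟩ := hK.exists_ratio_ge hsT htT hst.le hZ
    exact ⟨ρ, hρ⟩
  have hconv : ∀ ρ₁ ∈ ratioSet μ ℱ K s t, ∀ ρ₂ ∈ ratioSet μ ℱ K s t, ∀ a b : ℝ, 0 ≤ a → 0 ≤ b →
      a + b = 1 → (fun ω => ENNReal.ofReal a * ρ₁ ω + ENNReal.ofReal b * ρ₂ ω) ∈
        ratioSet μ ℱ K s t := by
    intro ρ₁ h₁ ρ₂ h₂ a b ha hb hab
    have := hK.mix_mem_ratioSet hsT htT hst.le h₁ h₂ (h := fun _ => a) stronglyMeasurable_const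
      (fun _ => ha) (fun _ => by linarith)
    rwa [show 1 - a = b by linarith] at this
  have hpol : ∀ g : Ω → ℝ≥0∞, Measurable[ℱ t] g → (∀ ω, g ω ≤ 1) → ∀ x,
      (∀ ρ ∈ ratioSet μ ℱ K s t, ∫⁻ ω, g ω * ρ ω ∂μ.trim (ℱ.le t) ≤ x) →
      ∫⁻ ω, g ω * f ω ∂μ.trim (ℱ.le t) ≤ x := by
    intro g hg hg1 x hx
    rw [lintegral_trim (f := fun ω => g ω * f ω) _ (hg.mul hfm)]
    refine hK.lintegral_mul_div_le hrc hCK hY hs hst ht hg hg1 fun ρ hρ => ?_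
    rw [← lintegral_trim (f := fun ω => g ω * ρ ω) (ℱ.le t) (hg.mul (hRm ρ hρ))]
    exact hx ρ hρ
  obtain ⟨ρ, hρ, hlim⟩ := exists_seq_tendsto_of_convex_solid (m := ℱ t)
    (μ := μ.trim (ℱ.le t)) hne hRm hconv
    (fun ρ hρ ρ' hm hle => hK.mem_ratioSet_of_le htT hst hρ hm hle) hfm
    ((ae_trim_ne_top_iff (ℱ.le t) hfm).2 hft) hpol
  exact ⟨ρ, hρ, ae_of_ae_trim _ hlim⟩

lemma exists_seq_tendsto_grid (hK : StableFamily μ T ℱ K)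
    (hrc : ∀ t : ℝ, (ℱ t : MeasurableSpace Ω) = ⨅ (s : ℝ) (_ : t < s), ℱ s)
    (hCK : C ⊆ K) (hY : Y ∈ procPolar μ T ℱ (procPolar μ T ℱ C))
    (hinit : ∃ Z : ℕ → ℝ → Ω → ℝ, (∀ n, Z n ∈ K) ∧
      ∀ᵐ ω ∂μ, Tendsto (fun n => Z n 0 ω) atTop (𝓝 (Y 0 ω)))
    {p : ℕ → ℝ} (hp0 : p 0 = 0) (hp : StrictMono p) (N : ℕ) (hpT : p N ≤ T) :
    ∃ Z : ℕ → ℝ → Ω → ℝ, (∀ n, Z n ∈ K) ∧ ∀ᵐ ω ∂μ, ∀ j ≤ N,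
      Tendsto (fun n => Z n (p j) ω) atTop (𝓝 (Y (p j) ω)) := by
  induction N with
  | zero =>
    obtain ⟨Z, hZ, hlim⟩ := hinit
    refine ⟨Z, hZ, ?_⟩
    filter_upwards [hlim] with ω h j hj
    rw [Nat.le_zero.1 hj, hp0]
    exact h
  | succ N ih =>
    have hlt : p N < p (N + 1) := hp N.lt_succ_self
    have h0 : 0 ≤ p N := hp0 ▸ hp.monotone (Nat.zero_le N)
    have hs : p N ∈ Icc (0 : ℝ) T := ⟨h0, hlt.le.trans hpT⟩
    have ht : p (N + 1) ∈ Icc (0 : ℝ) T := ⟨h0.trans hlt.le, hpT⟩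
    obtain ⟨Z, hZ, hlim⟩ := ih hs.2
    obtain ⟨ρ, hρ, hρlim⟩ := hK.exists_seq_ratio_tendsto hrc hCK hY h0 hlt hpT
    choose V hV hVlt hVeq hVt using fun n => hK.exists_concat hs hlt.le (hZ n) (hρ n)
    have hYS := hK.superMG_of_mem_bipolar hCK hY
    refine ⟨V, hV, ?_⟩
    filter_upwards [hlim, hρlim, ae_all_iff.2 hVeq, ae_all_iff.2 hVt,
      ae_all_iff.2 fun n => (hK.s1mem _ (hV n)).1.1.nonneg ht, hYS.1.nonneg ht, hYS.1.nonneg hs,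
      hYS.ae_eq_zero_of_eq_zero hs ht hlt.le] with ω h1 h2 h3 h4 h5 h6 h7 h8 j hj
    rcases Nat.lt_trichotomy j N with hjN | rfl | hjN
    · refine (h1 j hjN.le).congr fun n => ?_
      rw [hVlt n _ (hp hjN)]
    · exact (h1 j le_rfl).congr fun n => (h3 n).symm
    · obtain rfl : j = N + 1 := le_antisymm hj hjN
      have hq : ENNReal.ofReal (Y (p (N + 1)) ω) / ENNReal.ofReal (Y (p N) ω) ≠ ∞ ∧
          ENNReal.ofReal (Y (p N) ω) *
            (ENNReal.ofReal (Y (p (N + 1)) ω) / ENNReal.ofReal (Y (p N) ω)) =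
          ENNReal.ofReal (Y (p (N + 1)) ω) := by
        rcases h7.eq_or_lt with h | h
        · simp [h8 h.symm]
        · have hne : ENNReal.ofReal (Y (p N) ω) ≠ 0 := by simpa using h
          exact ⟨ENNReal.div_ne_top ENNReal.ofReal_ne_top hne,
            ENNReal.mul_div_cancel hne ENNReal.ofReal_ne_top⟩
      have hm := ENNReal.Tendsto.mul (ENNReal.tendsto_ofReal (h1 N le_rfl)) (Or.inr hq.1) h2
        (Or.inr ENNReal.ofReal_ne_top)
      rw [hq.2] at hm
      have hr := (ENNReal.tendsto_toReal ENNReal.ofReal_ne_top).comp hm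
      rw [ENNReal.toReal_ofReal h6] at hr
      refine hr.congr fun n => ?_
      simp only [Function.comp_apply]
      rw [← h4 n, ENNReal.toReal_ofReal (h5 n)]

end StableFamily

end

section

variable {m0 : MeasurableSpace Ω} {μ : Measure Ω} {T : ℝ}
  {ℱ : Filtration ℝ m0} {K C : Set (ℝ → Ω → ℝ)} {Y : ℝ → Ω → ℝ}

lemma posProc_const {a : ℝ} (ha : 0 ≤ a) : PosProc μ T ℱ fun _ _ => a :=
  ⟨fun _ _ => stronglyMeasurable_const, ae_of_all _ fun _ _ _ => ha,
    ae_of_all _ fun _ => ⟨fun _ _ => tendsto_const_nhds, fun _ _ => ⟨a, tendsto_const_nhds⟩⟩⟩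

lemma SuperMG.mul_const {X : ℝ → Ω → ℝ} (hX : SuperMG μ T ℱ X) {a : ℝ} (ha : 0 ≤ a) :
    SuperMG μ T ℱ fun t ω => X t ω * a := by
  refine ⟨hX.1.mul (posProc_const ha), fun t ht => (hX.2.1 t ht).mul_const a,
    fun s t hs ht hst => ?_⟩
  have h : (fun ω => X t ω * a) = a • X t := by
    ext ω
    simp [mul_comm]
  simp only [h]
  filter_upwards [condExp_smul a (X t) (ℱ s) (μ := μ), hX.2.2 s t hs ht hst] with ω h1 h2
  rw [h1, Pi.smul_apply, smul_eq_mul, mul_comm]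
  exact mul_le_mul_of_nonneg_right h2 ha

/-- Functions measurable for a trivial σ-algebra are a.s. constant. -/
lemma exists_ae_eq_const_of_trivial [IsProbabilityMeasure μ] {m : MeasurableSpace Ω} (hm : m ≤ m0)
    (htriv : ∀ A : Set Ω, MeasurableSet[m] A → μ A = 0 ∨ μ A = 1) {f : Ω → ℝ}
    (hf : Measurable[m] f) : ∃ a : ℝ, ∀ᵐ ω ∂μ, f ω = a := by
  refine exists_eventuallyEq_const_of_forall_separating (l := ae μ) MeasurableSet fun U hU => ?_
  rcases htriv _ (hf hU) with h | h
  · exact Or.inr (measure_eq_zero_iff_ae_notMem.1 h)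
  · exact Or.inl ((mem_ae_iff_prob_eq_one (hm _ (hf hU))).2 h)

variable [IsProbabilityMeasure μ]

lemma StableFamily.exists_seq_tendsto_zero (hK : StableFamily μ T ℱ K) (hT : 0 < T)
    (htriv : ∀ A : Set Ω, MeasurableSet[ℱ 0] A → μ A = 0 ∨ μ A = 1)
    (hCK : C ⊆ K) (hfar : FarReaching μ T C) (hY : Y ∈ procPolar μ T ℱ (procPolar μ T ℱ C)) :
    ∃ Z : ℕ → ℝ → Ω → ℝ, (∀ n, Z n ∈ K) ∧
      ∀ᵐ ω ∂μ, Tendsto (fun n => Z n 0 ω) atTop (𝓝 (Y 0 ω)) := by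
  have h0 : (0 : ℝ) ∈ Icc 0 T := ⟨le_rfl, hT.le⟩
  have hconst : ∀ X : ℝ → Ω → ℝ, PosProc μ T ℱ X → ∃ a : ℝ, 0 ≤ a ∧ ∀ᵐ ω ∂μ, X 0 ω = a := by
    intro X hX
    obtain ⟨a, ha⟩ := exists_ae_eq_const_of_trivial (ℱ.le 0) htriv (hX.1 0 h0).measurable
    obtain ⟨ω, h1, h2⟩ := (ha.and (hX.nonneg h0)).exists
    exact ⟨a, h1 ▸ h2, ha⟩
  set S : Set ℝ := {a | ∃ Z ∈ C, ∀ᵐ ω ∂μ, Z 0 ω = a} with hS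
  have hSb : BddAbove S := by
    refine ⟨1, ?_⟩
    rintro a ⟨Z, hZ, ha⟩
    obtain ⟨ω, h1, h2⟩ := (ha.and (hK.s1mem Z (hCK hZ)).2).exists
    exact h1 ▸ h2
  obtain ⟨Z₀, hZ₀, hpos⟩ := hfar
  have hZ₀S := (hK.s1mem Z₀ (hCK hZ₀)).1
  obtain ⟨a₀, -, ha₀⟩ := hconst Z₀ hZ₀S.1
  have ha₀S : a₀ ∈ S := ⟨Z₀, hZ₀, ha₀⟩
  have hσ : 0 < sSup S := by
    obtain ⟨ω, h1, h2⟩ := (ha₀.and (hZ₀S.ae_pos_of_le h0 ⟨hT.le, le_rfl⟩ hT.le hpos)).exists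
    exact (h1 ▸ h2 : 0 < a₀).trans_le (le_csSup hSb ha₀S)
  have hX : (fun _ _ => (sSup S)⁻¹ : ℝ → Ω → ℝ) ∈ procPolar μ T ℱ C := by
    refine ⟨posProc_const (inv_nonneg.2 hσ.le), fun Z hZ =>
      ⟨(hK.s1mem Z (hCK hZ)).1.mul_const (inv_nonneg.2 hσ.le), ?_⟩⟩
    obtain ⟨a, -, ha⟩ := hconst Z (hK.s1mem Z (hCK hZ)).1.1
    filter_upwards [ha] with ω h
    rw [h, ← div_eq_mul_inv, div_le_one hσ]
    exact le_csSup hSb ⟨Z, hZ, ha⟩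
  obtain ⟨y, hy0, hy⟩ := hconst Y hY.1
  have hyσ : (sSup S)⁻¹ * y ≤ 1 := by
    obtain ⟨ω, h1, h2⟩ := (hy.and (hY.2 _ hX).2).exists
    exact h1 ▸ h2
  obtain ⟨u, -, hu, huS⟩ := exists_seq_tendsto_sSup ⟨a₀, ha₀S⟩ hSb
  choose Z hZ hZu using huS
  have hy0' : 0 ≤ (sSup S)⁻¹ * y := mul_nonneg (inv_nonneg.2 hσ.le) hy0
  refine ⟨fun n t ω => Z n t ω * ((sSup S)⁻¹ * y), fun n => hK.solid _ (hCK (hZ n)) _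
    ⟨posProc_const hy0', ae_of_all _ fun _ _ _ _ _ _ => le_rfl, ae_of_all _ fun _ => hyσ⟩, ?_⟩
  filter_upwards [ae_all_iff.2 hZu, hy] with ω h1 h2
  simp only [h1, h2]
  have := hu.mul_const ((sSup S)⁻¹ * y)
  rwa [mul_inv_cancel_left₀ hσ.ne'] at this

lemma stableFamily_solidForkHull (hfar : FarReaching μ T C)
    {D : Set (ℝ → Ω → ℝ)} (hD : D ⊆ {X | S1mem μ T ℱ X} ∧ ProcSolid μ T ℱ D ∧
      ForkConvex μ T ℱ D ∧ C ⊆ D) : StableFamily μ T ℱ (solidForkHull μ T ℱ C) where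
  s1mem X hX := hD.1 (hX D hD)
  solid X hX B hB E hE := hE.2.1 X (hX E hE) B hB
  fork s hs h hh h0 h1 Y1 hY1 Y2 hY2 Y3 hY3 E hE :=
    hE.2.2.1 s hs h hh h0 h1 Y1 (hY1 E hE) Y2 (hY2 E hE) Y3 (hY3 E hE)
  far := by
    obtain ⟨Z, hZ, hpos⟩ := hfar
    exact ⟨Z, fun E hE => hE.2.2.2 hZ, hpos⟩

/-- Diagonal extraction: a.s. convergent sequences on each of increasingly many indices yield one
sequence converging a.s. at every index. -/
lemma exists_diagonal_tendsto {ι : Type*} {V : ℕ → ℕ → ι → Ω → ℝ} {y : ι → Ω → ℝ}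
    {F : ℕ → Finset ι} (hF : Monotone F)
    (hmeas : ∀ k n, ∀ i ∈ F k, AEStronglyMeasurable (V k n i) μ)
    (hlim : ∀ k, ∀ᵐ ω ∂μ, ∀ i ∈ F k, Tendsto (fun n => V k n i ω) atTop (𝓝 (y i ω))) :
    ∃ n : ℕ → ℕ, ∀ᵐ ω ∂μ, ∀ k, ∀ i ∈ F k,
      Tendsto (fun l => V l (n l) i ω) atTop (𝓝 (y i ω)) := by
  have hex : ∀ k, ∃ n, μ {ω | ∃ i ∈ F k, (1 / 2 : ℝ) ^ k ≤ dist (V k n i ω) (y i ω)} ≤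
      (2⁻¹ : ℝ≥0∞) ^ k := by
    intro k
    have htend : ∀ i ∈ F k, Tendsto (fun n => μ {ω | (1 / 2 : ℝ) ^ k ≤
        dist (V k n i ω) (y i ω)}) atTop (𝓝 0) := fun i hi => by
      have := tendstoInMeasure_of_tendsto_ae (fun n => hmeas k n i hi)
        ((hlim k).mono fun ω h => h i hi)
      exact tendstoInMeasure_iff_dist.1 this _ (by positivity)
    have hsum := tendsto_finsetSum (F k) htend
    rw [Finset.sum_const_zero] at hsum
    obtain ⟨n, hn⟩ := (hsum.eventually_le_const
      (show (0 : ℝ≥0∞) < (2⁻¹ : ℝ≥0∞) ^ k from ENNReal.pow_pos (by simp) k)).exists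
    refine ⟨n, le_trans ?_ hn⟩
    refine le_trans (le_of_eq ?_) (measure_biUnion_finset_le (F k) _)
    congr 1
    ext ω
    simp
  choose n hn using hex
  refine ⟨n, ?_⟩
  have hBC := ae_eventually_notMem (μ := μ) (s := fun k =>
    {ω | ∃ i ∈ F k, (1 / 2 : ℝ) ^ k ≤ dist (V k (n k) i ω) (y i ω)}) ?_
  · filter_upwards [hBC] with ω h k i hi
    rw [tendsto_iff_dist_tendsto_zero]
    refine squeeze_zero' (Eventually.of_forall fun _ => dist_nonneg) ?_
      (tendsto_pow_atTop_nhds_zero_of_lt_one (r := (1 / 2 : ℝ)) (by norm_num) (by norm_num))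
    filter_upwards [h, eventually_ge_atTop k] with l hl hkl
    by_contra! hcon
    exact hl ⟨i, hF hkl hi, hcon.le⟩
  · refine ((ENNReal.tsum_le_tsum hn).trans_lt ?_).ne
    rw [ENNReal.tsum_geometric]
    simp

end

/-- The dyadic points of `[0,T]` of level `k`. -/
noncomputable def dyadicLevel (T : ℝ) (k : ℕ) : Finset ℝ :=
  (Finset.range (2 ^ k + 1)).image fun j : ℕ => (j : ℝ) / 2 ^ k * T

lemma mem_dyadicLevel {T : ℝ} {k : ℕ} {q : ℝ} :
    q ∈ dyadicLevel T k ↔ ∃ j : ℕ, j ≤ 2 ^ k ∧ (j : ℝ) / 2 ^ k * T = q := by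
  simp [dyadicLevel]

lemma dyadicLevel_mono (T : ℝ) : Monotone (dyadicLevel T) := by
  refine monotone_nat_of_le_succ fun k q hq => ?_
  obtain ⟨j, hj, rfl⟩ := mem_dyadicLevel.1 hq
  refine mem_dyadicLevel.2 ⟨2 * j, by rw [pow_succ]; lia, ?_⟩
  push_cast
  rw [pow_succ]
  field_simp

/-- Approximation of elements of the process bipolar by elements of the solid,
fork-convex hull of `C`, a.s. at all dyadic points of `[0,T]`. -/
theorem bipolar_dyadic_approx {m0 : MeasurableSpace Ω} (μ : Measure Ω)
    [IsProbabilityMeasure μ] (T : ℝ) (hT : 0 < T) (ℱ : Filtration ℝ m0)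
    (hrc : ∀ t : ℝ, (ℱ t : MeasurableSpace Ω) = ⨅ (s : ℝ) (_ : t < s), ℱ s)
    (hcomp : ∀ A : Set Ω, μ A = 0 → MeasurableSet[ℱ 0] A)
    (htriv : ∀ A : Set Ω, MeasurableSet[ℱ 0] A → μ A = 0 ∨ μ A = 1)
    (C : Set (ℝ → Ω → ℝ)) (hC : ∀ X ∈ C, S1mem μ T ℱ X) (hfar : FarReaching μ T C)
    (Y : ℝ → Ω → ℝ) (hY : Y ∈ procPolar μ T ℱ (procPolar μ T ℱ C)) :
    ∃ Yn : ℕ → ℝ → Ω → ℝ, (∀ n, Yn n ∈ solidForkHull μ T ℱ C) ∧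
      ∀ᵐ ω ∂μ, ∀ q ∈ dyadics T,
        Filter.Tendsto (fun n => Yn n q ω) Filter.atTop (nhds (Y q ω)) := by
  by_cases hD : ∃ D : Set (ℝ → Ω → ℝ), D ⊆ {X | S1mem μ T ℱ X} ∧ ProcSolid μ T ℱ D ∧
      ForkConvex μ T ℱ D ∧ C ⊆ D
  swap
  · exact ⟨fun _ => Y, fun n E hE => absurd ⟨E, hE⟩ hD, ae_of_all _ fun ω q _ =>
      tendsto_const_nhds⟩
  obtain ⟨D, hD⟩ := hD
  have hK := stableFamily_solidForkHull hfar hD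
  have hCK : C ⊆ solidForkHull μ T ℱ C := fun Z hZ E hE => hE.2.2.2 hZ
  have hinit := hK.exists_seq_tendsto_zero hT htriv hCK hfar hY
  have hgrid : ∀ k : ℕ, ∃ Z : ℕ → ℝ → Ω → ℝ, (∀ n, Z n ∈ solidForkHull μ T ℱ C) ∧
      ∀ᵐ ω ∂μ, ∀ q ∈ dyadicLevel T k, Tendsto (fun n => Z n q ω) atTop (𝓝 (Y q ω)) := by
    intro k
    have hp : StrictMono fun j : ℕ => (j : ℝ) / 2 ^ k * T := by
      intro i j hij
      have : (i : ℝ) < j := by exact_mod_cast hij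
      dsimp only
      gcongr
    obtain ⟨Z, hZ, hlim⟩ := hK.exists_seq_tendsto_grid hrc hCK hY hinit (by simp) hp (2 ^ k)
      (by simp)
    refine ⟨Z, hZ, ?_⟩
    filter_upwards [hlim] with ω h q hq
    obtain ⟨j, hj, rfl⟩ := mem_dyadicLevel.1 hq
    exact h j hj
  choose V hV hVlim using hgrid
  have hmeas : ∀ k n, ∀ q ∈ dyadicLevel T k, AEStronglyMeasurable (V k n q) μ := by
    intro k n q hq
    obtain ⟨j, hj, rfl⟩ := mem_dyadicLevel.1 hq
    have hj' : (j : ℝ) ≤ 2 ^ k := by exact_mod_cast hj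
    refine (((hK.s1mem _ (hV k n)).1.1.1 _ ⟨by positivity, ?_⟩).mono (ℱ.le _)).aestronglyMeasurable
    exact mul_le_of_le_one_left hT.le ((div_le_one (by positivity)).2 hj')
  obtain ⟨n, hn⟩ := exists_diagonal_tendsto (dyadicLevel_mono T) hmeas hVlim
  refine ⟨fun l => V l (n l), fun l => hV _ _, ?_⟩
  filter_upwards [hn] with ω h q hq
  obtain ⟨j, k, hj, rfl⟩ := hq
  exact h k _ (mem_dyadicLevel.2 ⟨j, hj, rfl⟩)
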